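/- For every K ≥ 1 there exists C > 0 depending only on K with the following property. Assume f : ℝ³ × ℝ × ℝ³ → ℝ is of class C² with f ≥ 1/K everywhere and with |f| and all partial derivatives of f up to order 2 bounded by K; u : ℝ³ → ℝ is C^∞ on B₁₀ with σ₂(D²u(x)) = f(x, u(x), Du(x)) and Δu(x) > 0 on B₁₀; and |u(x)| + |Du(x)| ≤ K on B₁₀. Let y₀ be a point of the closed ball of radius 1 about the origin at which Δu attains its maximum over that closed ball. Then, with F(x) := f(x, u(x), Du(x)): Δu(y₀) ≤ C · ∫_{B₁(y₀)} Δu(x)·(F(x)·Δu(x) − det D²u(x)) dx. -/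

import Mathlib

open Metric MeasureTheory Real

noncomputable section

abbrev E3 : Type := EuclideanSpace ℝ (Fin 3)

/-- The `i`-th partial derivative of `u`. -/
def pd (i : Fin 3) (u : E3 → ℝ) : E3 → ℝ :=
  fun x => fderiv ℝ u x (EuclideanSpace.single i 1)

/-- The gradient `Du` of `u` as a vector in `ℝ³`. -/
def grad (u : E3 → ℝ) (x : E3) : E3 :=
  (WithLp.equiv 2 (Fin 3 → ℝ)).symm (fun i => pd i u x)

/-- The Hessian matrix `D²u`. -/
def hess (u : E3 → ℝ) (x : E3) : Matrix (Fin 3) (Fin 3) ℝ :=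
  Matrix.of fun i j => pd i (pd j u) x

/-- The Laplacian `Δu`. -/
def lap (u : E3 → ℝ) (x : E3) : ℝ := ∑ i, hess u x i i

def sigma1 (A : Matrix (Fin 3) (Fin 3) ℝ) : ℝ := A.trace

def sigma2 (A : Matrix (Fin 3) (Fin 3) ℝ) : ℝ := (A.trace ^ 2 - (A * A).trace) / 2

def sigma3 (A : Matrix (Fin 3) (Fin 3) ℝ) : ℝ := A.det

/-- The matrix `σ₂^{ij}(x) = Δu(x) δ_{ij} - ∂_i∂_j u(x)`. -/
def sg (u : E3 → ℝ) (x : E3) : Matrix (Fin 3) (Fin 3) ℝ :=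
  lap u x • (1 : Matrix (Fin 3) (Fin 3) ℝ) - hess u x

/-- `f_{u_p}`: the partial derivative of `f` in its `p`-th gradient variable,
evaluated at `(x, u(x), Du(x))`. -/
def fp (f : E3 × ℝ × E3 → ℝ) (u : E3 → ℝ) (p : Fin 3) (x : E3) : ℝ :=
  fderiv ℝ f (x, u x, grad u x) (0, 0, EuclideanSpace.single p 1)

/-- The standing hypotheses: `f` is `C²`, bounded below by `1/K`, with `|f|` and all
derivatives up to order 2 bounded by `K`; `u` is smooth on `B₁₀`, solves
`σ₂(D²u) = f(x,u,Du)` with `Δu > 0` on `B₁₀`, and `|u| + |Du| ≤ K` on `B₁₀`. -/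
def Hyp (K : ℝ) (f : E3 × ℝ × E3 → ℝ) (u : E3 → ℝ) : Prop :=
  ContDiff ℝ 2 f ∧
  (∀ z, 1 / K ≤ f z) ∧
  (∀ z, ∀ k : ℕ, k ≤ 2 → ‖iteratedFDeriv ℝ k f z‖ ≤ K) ∧
  ContDiffOn ℝ (⊤ : ℕ∞) u (ball (0 : E3) 10) ∧
  (∀ x ∈ ball (0 : E3) 10, sigma2 (hess u x) = f (x, u x, grad u x)) ∧
  (∀ x ∈ ball (0 : E3) 10, 0 < lap u x) ∧
  (∀ x ∈ ball (0 : E3) 10, |u x| + ‖grad u x‖ ≤ K)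

/-- trace of a `3 × 3` array -/
def tA (H : Fin 3 → Fin 3 → ℝ) : ℝ := ∑ i, H i i
/-- second symmetric function of a symmetric array -/
def fA (H : Fin 3 → Fin 3 → ℝ) : ℝ := ((tA H) ^ 2 - ∑ i, ∑ j, H i j ^ 2) / 2
/-- cofactor-type matrix -/
def sA (H : Fin 3 → Fin 3 → ℝ) (i j : Fin 3) : ℝ := (if i = j then tA H else 0) - H i j
/-- volume density -/
def wA (H : Fin 3 → Fin 3 → ℝ) : ℝ := fA H * tA H - (Matrix.of H).det

lemma quad_bound (H : Fin 3 → Fin 3 → ℝ) (ht : 0 < tA H) (hf : 0 < fA H) (v : Fin 3 → ℝ) :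
    |∑ i, ∑ j, H i j * v i * v j| ≤ tA H * ∑ i, v i ^ 2 := by
  have h1 := Finset.sum_mul_sq_le_sq_mul_sq (Finset.univ : Finset (Fin 3 × Fin 3))
    (fun p => H p.1 p.2) (fun p => v p.1 * v p.2)
  have h2 : ∑ p : Fin 3 × Fin 3, (v p.1 * v p.2) ^ 2 = (∑ i, v i ^ 2) ^ 2 := by
    rw [Fintype.sum_prod_type, sq, Finset.sum_mul_sum]
    simp [mul_pow]
  rw [h2] at h1
  simp only [Fintype.sum_prod_type] at h1
  have h3 : ∑ i, ∑ j, H i j ^ 2 ≤ tA H ^ 2 := by unfold fA at hf; linarith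
  have h4 : ∑ i, ∑ j, H i j * v i * v j = ∑ i, ∑ j, H i j * (v i * v j) := by
    simp [mul_assoc]
  rw [h4]
  have hn : 0 ≤ ∑ i, v i ^ 2 := Finset.sum_nonneg fun _ _ => sq_nonneg _
  apply abs_le_of_sq_le_sq _ (by positivity)
  calc _ ≤ _ := h1
    _ ≤ tA H ^ 2 * (∑ i, v i ^ 2) ^ 2 := by gcongr
    _ = _ := by ring

lemma sA_quad (H : Fin 3 → Fin 3 → ℝ) (v : Fin 3 → ℝ) :
    ∑ i, ∑ j, sA H i j * v i * v j = tA H * ∑ i, v i ^ 2 - ∑ i, ∑ j, H i j * v i * v j := by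
  simp [sA, Fin.sum_univ_three]; ring

lemma sA_nonneg (H : Fin 3 → Fin 3 → ℝ) (ht : 0 < tA H) (hf : 0 < fA H) (v : Fin 3 → ℝ) :
    0 ≤ ∑ i, ∑ j, sA H i j * v i * v j := by
  have := abs_le.1 (quad_bound H ht hf v); rw [sA_quad]; linarith

lemma sA_le (H : Fin 3 → Fin 3 → ℝ) (ht : 0 < tA H) (hf : 0 < fA H) (v : Fin 3 → ℝ) :
    ∑ i, ∑ j, sA H i j * v i * v j ≤ 2 * tA H * ∑ i, v i ^ 2 := by
  have := abs_le.1 (quad_bound H ht hf v); rw [sA_quad]; linarith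

lemma sym3 {H : Fin 3 → Fin 3 → ℝ} (hs : ∀ i j, H i j = H j i) :
    H 1 0 = H 0 1 ∧ H 2 0 = H 0 2 ∧ H 2 1 = H 1 2 := ⟨hs _ _, hs _ _, hs _ _⟩

lemma wA_trace (H : Fin 3 → Fin 3 → ℝ) (hs : ∀ i j, H i j = H j i) (f0 : ℝ) :
    ∑ i, ∑ j, sA H i j * ((if i = j then 2 * f0 else 0) + 2 * ∑ k, H k i * H k j)
      = 6 * wA H + 4 * (f0 - fA H) * tA H := by
  obtain ⟨h1, h2, h3⟩ := sym3 hs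
  simp [wA, sA, fA, tA, Fin.sum_univ_three, Matrix.det_fin_three, h1, h2, h3]; ring

lemma wA_lower (H : Fin 3 → Fin 3 → ℝ) (hs : ∀ i j, H i j = H j i) (ht : 0 < tA H)
    (hf : 0 < fA H) : 2 / 3 * fA H * tA H ≤ wA H := by
  have h0 := wA_trace H hs 0
  have h1 : ∑ i, ∑ j, sA H i j * ((if i = j then 2 * (0:ℝ) else 0) + 2 * ∑ k, H k i * H k j)
     = 2 * ∑ k, ∑ i, ∑ j, sA H i j * H k i * H k j := by
    simp [Fin.sum_univ_three]; ring
  have h2 : 0 ≤ ∑ k, ∑ i, ∑ j, sA H i j * H k i * H k j :=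
    Finset.sum_nonneg fun k _ => sA_nonneg H ht hf (H k)
  nlinarith

lemma grad_ident (H : Fin 3 → Fin 3 → ℝ) (hs : ∀ i j, H i j = H j i) (f0 : ℝ) (z q : Fin 3 → ℝ) :
    ∑ i, ∑ j, sA H i j * (f0 * z i + ∑ k, q k * H k i) * (f0 * z j + ∑ k, q k * H k j)
      = wA H * (f0 * ∑ i, z i ^ 2 + ∑ i, q i ^ 2)
        - f0 * (∑ i, ∑ j, sA H i j * (∑ k, H i k * z k - q i) * (∑ k, H j k * z k - q j))
        - (fA H - f0) * (f0 * (∑ i, ∑ j, sA H i j * z i * z j) + ∑ i, ∑ j, sA H i j * q i * q j) := by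
  obtain ⟨h1, h2, h3⟩ := sym3 hs
  simp only [Fin.sum_univ_three, h1, h2, h3]
  simp [wA, sA, fA, tA, Fin.sum_univ_three, Matrix.det_fin_three, h1, h2, h3]
  ring

lemma grad_bound (H : Fin 3 → Fin 3 → ℝ) (hs : ∀ i j, H i j = H j i) (ht : 0 < tA H)
    (hf : 0 < fA H) {f0 : ℝ} (hf0 : 0 < f0) (z q : Fin 3 → ℝ) :
    ∑ i, ∑ j, sA H i j * (f0 * z i + ∑ k, q k * H k i) * (f0 * z j + ∑ k, q k * H k j)
      ≤ (wA H + 2 * |fA H - f0| * tA H) * (f0 * ∑ i, z i ^ 2 + ∑ i, q i ^ 2) := by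
  rw [grad_ident H hs]
  have h1 := sA_nonneg H ht hf (fun i => ∑ k, H i k * z k - q i)
  have h2 := sA_nonneg H ht hf z
  have h3 := sA_nonneg H ht hf q
  have h4 := sA_le H ht hf z
  have h5 := sA_le H ht hf q
  set a := ∑ i, ∑ j, sA H i j * z i * z j
  set b := ∑ i, ∑ j, sA H i j * q i * q j
  have h6 : f0 * a + b ≤ 2 * tA H * (f0 * ∑ i, z i ^ 2 + ∑ i, q i ^ 2) := by
    have := mul_le_mul_of_nonneg_left h4 hf0.le
    linarith
  have h7 : -((fA H - f0) * (f0 * a + b)) ≤ |fA H - f0| * (f0 * a + b) := by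
    have : 0 ≤ f0 * a + b := by positivity
    rw [← neg_mul]; gcongr; exact neg_le_abs _
  have h8 := mul_le_mul_of_nonneg_left h6 (abs_nonneg (fA H - f0))
  have h9 := mul_nonneg hf0.le h1
  linarith

lemma reverse_cs (H X : Fin 3 → Fin 3 → ℝ) (hf : 0 < fA H) :
    (tA X) ^ 2 - ∑ i, ∑ j, X i j ^ 2 ≤ (∑ i, ∑ j, sA H i j * X i j) ^ 2 / (2 * fA H) := by
  set P := ∑ i, ∑ j, sA H i j * X i j with hP
  have h1 := Finset.sum_mul_sq_le_sq_mul_sq (Finset.univ : Finset (Fin 3 × Fin 3))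
    (fun p => H p.1 p.2) (fun p => X p.1 p.2)
  simp only [Fintype.sum_prod_type] at h1
  have h2 : ∑ i, ∑ j, H i j * X i j = tA H * tA X - P := by
    simp [hP, sA, tA, Fin.sum_univ_three]; ring
  have h3 : ∑ i, ∑ j, H i j ^ 2 = tA H ^ 2 - 2 * fA H := by unfold fA; ring
  have hpos : 0 ≤ ∑ i, ∑ j, H i j ^ 2 := by positivity
  rw [h2, h3] at h1
  rw [h3] at hpos
  set n := ∑ i, ∑ j, X i j ^ 2
  have hn : 0 < tA H ^ 2 - 2 * fA H := by
    rcases hpos.lt_or_eq with h | h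
    · exact h
    · exfalso
      rw [← h] at h3
      have hz : ∀ i j, H i j = 0 := by
        intro i j
        have a1 := (Finset.sum_eq_zero_iff_of_nonneg (fun i _ => by positivity)).1 h3 i (Finset.mem_univ i)
        have a2 := (Finset.sum_eq_zero_iff_of_nonneg (fun i _ => by positivity)).1 a1 j (Finset.mem_univ j)
        exact pow_eq_zero_iff (two_ne_zero) |>.1 a2
      simp [fA, tA, hz] at hf
  rw [le_div_iff₀ (by positivity)]
  set a := tA H; set α := tA X; set F := fA H
  have key : (α ^ 2 - n) * (2 * F) * (a ^ 2 - 2 * F) ≤ P ^ 2 * (a ^ 2 - 2 * F) := by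
    nlinarith [sq_nonneg (2 * F * α - a * P)]
  exact le_of_mul_le_mul_right key hn

lemma wA_det (H : Fin 3 → Fin 3 → ℝ) (hs : ∀ i j, H i j = H j i) :
    (fA H • (1 : Matrix (Fin 3) (Fin 3) ℝ) + (Matrix.of H) * (Matrix.of H)).det = wA H ^ 2 := by
  obtain ⟨h1, h2, h3⟩ := sym3 hs
  simp [wA, fA, tA, Fin.sum_univ_three, Matrix.det_fin_three, Matrix.mul_apply, h1, h2, h3]
  ring

lemma entry_le (H : Fin 3 → Fin 3 → ℝ) (ht : 0 < tA H) (hf : 0 < fA H) (i j : Fin 3) :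
    |H i j| ≤ tA H := by
  have h3 : ∑ i, ∑ j, H i j ^ 2 ≤ tA H ^ 2 := by unfold fA at hf; linarith
  apply abs_le_of_sq_le_sq _ ht.le
  refine le_trans ?_ h3
  refine le_trans ?_ (Finset.single_le_sum (f := fun i => ∑ j, H i j ^ 2) (fun i _ => by positivity) (Finset.mem_univ i))
  exact (Finset.single_le_sum (f := fun j => H i j ^ 2) (fun i _ => by positivity) (Finset.mem_univ j))

lemma poly_absorb (C1 : ℝ) (hC1 : 0 ≤ C1) : ∃ C2, 0 ≤ C2 ∧ ∀ w : ℝ, 0 < w →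
    C1 * (2 * w ^ 4 + w ^ 3 + w ^ 2 + w) ≤ 1 / 4 * w ^ 5 + C2 := by
  set D := 20 * C1 + 1 with hD
  refine ⟨C1 * (2 * D ^ 4 + D ^ 3 + D ^ 2 + D), by positivity, fun w hw => ?_⟩
  rcases le_total w D with h | h
  · have : C1 * (2 * w ^ 4 + w ^ 3 + w ^ 2 + w) ≤ C1 * (2 * D ^ 4 + D ^ 3 + D ^ 2 + D) := by gcongr
    have : 0 ≤ 1 / 4 * w ^ 5 := by positivity
    linarith
  · have hw1 : 1 ≤ w := by nlinarith
    have h3 : w ^ 3 ≤ w ^ 4 := pow_le_pow_right₀ hw1 (by norm_num)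
    have h2 : w ^ 2 ≤ w ^ 4 := pow_le_pow_right₀ hw1 (by norm_num)
    have h1 : w ≤ w ^ 4 := by simpa using pow_le_pow_right₀ hw1 (show 1 ≤ 4 by norm_num)
    have h5 : C1 * (2 * w ^ 4 + w ^ 3 + w ^ 2 + w) ≤ C1 * (5 * w ^ 4) := by
      gcongr; linarith
    have h6 : 5 * C1 * w ^ 4 ≤ 1 / 4 * w * w ^ 4 :=
      mul_le_mul_of_nonneg_right (by linarith) (by positivity)
    have : 0 ≤ C1 * (2 * D ^ 4 + D ^ 3 + D ^ 2 + D) := by positivity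
    nlinarith

lemma rpow_w {τ : ℝ} (hτ : 0 < τ) (n : ℕ) : τ ^ (-(n:ℝ) / 4) = (τ ^ (-(1:ℝ) / 4)) ^ n := by
  rw [← rpow_natCast, ← rpow_mul hτ.le]; congr 1; ring

/-- the inner inequality -/
lemma inner_ineq {C1 C2 w e s sq X Y : ℝ} (hC1 : 0 ≤ C1) (hw : 0 < w) (he : 0 < e) (hs : 0 ≤ s)
    (hτ : (s + e) * w ^ 4 = 1) (hsq0 : 0 ≤ sq) (hsq : sq * w ^ 2 ≤ 1)
    (hX : |X - 6| ≤ C1 * sq) (hY : Y ≤ 4 * s + C1 * s * sq)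
    (h2 : C1 * (2 * w ^ 4 + w ^ 3 + w ^ 2 + w) ≤ 1 / 4 * w ^ 5 + C2) :
    -(1/2 * w ^ 6 + 1/4 * w ^ 5) * X + (3/4 * w ^ 10 + 5/16 * w ^ 9) * Y + C1 * (w ^ 2 + w)
      + C1 * sq * (1/2 * w ^ 6 + 1/4 * w ^ 5) ≤ C2 - 3 * e * w ^ 10 := by
  have hX' := (abs_le.1 hX).1
  set a := 1/2 * w ^ 6 + 1/4 * w ^ 5 with ha
  set b := 3/4 * w ^ 10 + 5/16 * w ^ 9 with hb
  have ha0 : 0 ≤ a := by positivity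
  have hb0 : 0 ≤ b := by positivity
  have e1 : -a * X ≤ -a * 6 + a * (C1 * sq) := by nlinarith
  have e2 : b * Y ≤ b * (4 * s + C1 * s * sq) := by gcongr
  have e3 : a * sq ≤ 1/2 * w ^ 4 + 1/4 * w ^ 3 := by
    have : a * sq = (1/2 * w ^ 4 + 1/4 * w ^ 3) * (sq * w ^ 2) := by rw [ha]; ring
    rw [this]; exact mul_le_of_le_one_right (by positivity) hsq
  have hs4 : s * w ^ 4 = 1 - e * w ^ 4 := by linarith
  have e4 : b * (s * sq) ≤ 3/4 * w ^ 4 + 5/16 * w ^ 3 := by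
    have : b * (s * sq) = (3/4 * w ^ 4 + 5/16 * w ^ 3) * ((s * w ^ 4) * (sq * w ^ 2)) := by
      rw [hb]; ring
    rw [this]
    refine mul_le_of_le_one_right (by positivity) ?_
    refine mul_le_one₀ ?_ (by positivity) hsq
    rw [hs4]; have : 0 < e * w ^ 4 := by positivity
    linarith
  have e5 : b * (4 * s) = 3 * w ^ 6 + 5/4 * w ^ 5 - e * (3 * w ^ 10 + 5/4 * w ^ 9) := by
    have : b * (4 * s) = (3 * w ^ 6 + 5/4 * w ^ 5) * (s * w ^ 4) := by rw [hb]; ring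
    rw [this, hs4]; ring
  have e6 : 0 ≤ e * w ^ 9 := by positivity
  have e7 := mul_le_mul_of_nonneg_left e3 hC1
  have e8 := mul_le_mul_of_nonneg_left e4 hC1
  have p4 : 0 ≤ C1 * w ^ 4 := by positivity
  have p3 : 0 ≤ C1 * w ^ 3 := by positivity
  have e9 : a * 6 = 3 * w ^ 6 + 3/2 * w ^ 5 := by rw [ha]; ring
  nlinarith

lemma outer_ineq {C1 M w w0 s0 s X Y c c1 c2 : ℝ} (hC1 : 0 ≤ C1) (hM : 0 ≤ M) (hw : 0 < w)
    (hw0 : w ≤ w0) (hs : 0 ≤ s) (hs0 : s ≤ s0)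
    (hX : |X - 6| ≤ C1 * √s) (hY0 : 0 ≤ Y) (hY : Y ≤ 4 * s + C1 * s * √s)
    (hc : |c| ≤ M) (hc1 : |c1| ≤ M) (hc2 : |c2| ≤ M) :
    (c1 * (w ^ 2 + w) + c * (-(1/2 * w ^ 6 + 1/4 * w ^ 5))) * X
     + (c2 * (w ^ 2 + w) + 2 * c1 * (-(1/2 * w ^ 6 + 1/4 * w ^ 5))
        + c * (3/4 * w ^ 10 + 5/16 * w ^ 9)) * Y + C1 * (c * (w ^ 2 + w))
      + C1 * √s * |c1 * (w ^ 2 + w) + c * (-(1/2 * w ^ 6 + 1/4 * w ^ 5))| ≤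
     (M * (w0 ^ 2 + w0) + M * (1/2 * w0 ^ 6 + 1/4 * w0 ^ 5)) * (6 + C1 * √s0)
     + (M * (w0 ^ 2 + w0) + 2 * M * (1/2 * w0 ^ 6 + 1/4 * w0 ^ 5)
        + M * (3/4 * w0 ^ 10 + 5/16 * w0 ^ 9)) * (4 * s0 + C1 * s0 * √s0)
      + C1 * (M * (w0 ^ 2 + w0))
      + C1 * √s0 * (M * (w0 ^ 2 + w0) + M * (1/2 * w0 ^ 6 + 1/4 * w0 ^ 5)) := by
  have hsq : √s ≤ √s0 := sqrt_le_sqrt hs0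
  have hw0' : 0 < w0 := by linarith
  have hs0' : 0 ≤ s0 := by linarith
  have a1 : |c1 * (w ^ 2 + w) + c * (-(1/2 * w ^ 6 + 1/4 * w ^ 5))| ≤
      M * (w0 ^ 2 + w0) + M * (1/2 * w0 ^ 6 + 1/4 * w0 ^ 5) := by
    refine (abs_add_le _ _).trans ?_
    rw [abs_mul, abs_mul, abs_neg, abs_of_pos (show 0 < w^2 + w by positivity),
      abs_of_pos (show 0 < 1/2 * w ^ 6 + 1/4 * w ^ 5 by positivity)]
    gcongr
  have a2 : |c2 * (w ^ 2 + w) + 2 * c1 * (-(1/2 * w ^ 6 + 1/4 * w ^ 5))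
        + c * (3/4 * w ^ 10 + 5/16 * w ^ 9)| ≤ (M * (w0 ^ 2 + w0) + 2 * M * (1/2 * w0 ^ 6 + 1/4 * w0 ^ 5)
        + M * (3/4 * w0 ^ 10 + 5/16 * w0 ^ 9)) := by
    refine (abs_add_three _ _ _).trans ?_
    rw [abs_mul, abs_mul, abs_mul, abs_mul, abs_neg, abs_of_pos (show 0 < w^2 + w by positivity),
      abs_of_pos (show 0 < 1/2 * w ^ 6 + 1/4 * w ^ 5 by positivity),
      abs_of_pos (show 0 < 3/4 * w ^ 10 + 5/16 * w ^ 9 by positivity), abs_two]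
    gcongr
  have a3 : |c * (w ^ 2 + w)| ≤ M * (w0 ^ 2 + w0) := by
    rw [abs_mul, abs_of_pos (show 0 < w^2 + w by positivity)]
    gcongr
  have hXb : |X| ≤ 6 + C1 * √s0 := by
    have : C1 * √s ≤ C1 * √s0 := by gcongr
    rw [abs_le] at *; constructor <;> linarith
  have hYb : |Y| ≤ 4 * s0 + C1 * s0 * √s0 := by
    rw [abs_of_nonneg hY0]; refine hY.trans ?_; gcongr
  have t1 := (le_abs_self _).trans ((abs_mul _ X).le.trans (mul_le_mul a1 hXb (abs_nonneg _) (by positivity)))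
  have t2 := (le_abs_self _).trans ((abs_mul _ Y).le.trans (mul_le_mul a2 hYb (abs_nonneg _) (by positivity)))
  have t3 := mul_le_mul_of_nonneg_left ((le_abs_self _).trans a3) hC1
  have t4 : C1 * √s * |c1 * (w ^ 2 + w) + c * (-(1/2 * w ^ 6 + 1/4 * w ^ 5))| ≤ C1 * √s0 * (M * (w0 ^ 2 + w0) + M * (1/2 * w0 ^ 6 + 1/4 * w0 ^ 5)) := by
    gcongr
  linarith

lemma phi_exists (s0 C1 : ℝ) (hs0 : 0 < s0) (hC1 : 0 ≤ C1) : ∃ C2, 0 ≤ C2 ∧ ∀ e, 0 < e →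
    ∃ φ φ1 φ2 : ℝ → ℝ, (∀ s, 0 ≤ s → ContDiffAt ℝ (⊤ : ℕ∞) φ s) ∧
    (∀ s, 0 ≤ s → HasDerivAt φ (φ1 s) s) ∧ (∀ s, 0 ≤ s → HasDerivAt φ1 (φ2 s) s) ∧
    (∀ s, 0 ≤ s → 0 ≤ φ s) ∧ (∀ s, s0 ≤ s → φ s = 0) ∧
    ∀ s, 0 ≤ s → ∀ X Y : ℝ, |X - 6| ≤ C1 * √s → 0 ≤ Y → Y ≤ 4 * s + C1 * s * √s →
      φ1 s * X + φ2 s * Y + C1 * φ s + C1 * √s * |φ1 s| ≤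
        C2 - (if s < s0 / 2 then 3 * e * (s + e) ^ (-(10:ℝ)/4) else 0) := by
  obtain ⟨D2, hD2, hD⟩ := poly_absorb C1 hC1
  set χ : ℝ → ℝ := fun s => smoothTransition (2 - 2 * s / s0) with hχ
  have hχc : ContDiff ℝ (⊤ : ℕ∞) χ := Real.smoothTransition.contDiff.comp (by fun_prop)
  have hχ1c : ContDiff ℝ (⊤ : ℕ∞) (deriv χ) :=
    ((contDiff_infty_iff_deriv (𝕜 := ℝ) (f := χ)).1 hχc).2
  have hχ2c : ContDiff ℝ (⊤ : ℕ∞) (deriv (deriv χ)) :=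
    ((contDiff_infty_iff_deriv (𝕜 := ℝ) (f := deriv χ)).1 hχ1c).2
  have hd1 : ∀ s, HasDerivAt χ (deriv χ s) s := fun s =>
    ((hχc.differentiable (by simp)) s).hasDerivAt
  have hd2 : ∀ s, HasDerivAt (deriv χ) (deriv (deriv χ) s) s := fun s =>
    ((hχ1c.differentiable (by simp)) s).hasDerivAt
  have hlow : ∀ s, s < s0 / 2 → χ s = 1 ∧ deriv χ s = 0 ∧ deriv (deriv χ) s = 0 := by
    have h0 : ∀ s, s < s0 / 2 → χ s = 1 := by
      intro s hs
      apply smoothTransition.one_of_one_le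
      have : 2 * s / s0 ≤ 1 := by rw [div_le_one hs0]; linarith
      linarith
    have h1 : ∀ s, s < s0 / 2 → deriv χ s = 0 := by
      intro s hs
      have : χ =ᶠ[nhds s] fun _ => 1 := by
        filter_upwards [Iio_mem_nhds hs] with t ht using h0 t ht
      rw [this.deriv_eq]; simp
    intro s hs
    refine ⟨h0 s hs, h1 s hs, ?_⟩
    have : deriv χ =ᶠ[nhds s] fun _ => 0 := by
      filter_upwards [Iio_mem_nhds hs] with t ht using h1 t ht
    rw [this.deriv_eq]; simp
  have hhigh : ∀ s, s0 < s → χ s = 0 ∧ deriv χ s = 0 ∧ deriv (deriv χ) s = 0 := by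
    have h0 : ∀ s, s0 < s → χ s = 0 := by
      intro s hs
      apply smoothTransition.zero_of_nonpos
      have : 2 ≤ 2 * s / s0 := by rw [le_div_iff₀ hs0]; linarith
      linarith
    have h1 : ∀ s, s0 < s → deriv χ s = 0 := by
      intro s hs
      have : χ =ᶠ[nhds s] fun _ => 0 := by
        filter_upwards [Ioi_mem_nhds hs] with t ht using h0 t ht
      rw [this.deriv_eq]; simp
    intro s hs
    refine ⟨h0 s hs, h1 s hs, ?_⟩
    have : deriv χ =ᶠ[nhds s] fun _ => 0 := by
      filter_upwards [Ioi_mem_nhds hs] with t ht using h1 t ht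
    rw [this.deriv_eq]; simp
  obtain ⟨M, hM⟩ : ∃ M, ∀ s ∈ Set.Icc 0 s0, |χ s| + |deriv χ s| + |deriv (deriv χ) s| ≤ M := by
    have hc : Continuous (fun s => |χ s| + |deriv χ s| + |deriv (deriv χ) s|) :=
      (hχc.continuous.abs.add hχ1c.continuous.abs).add hχ2c.continuous.abs
    obtain ⟨M, hM⟩ := (isCompact_Icc (a := (0:ℝ)) (b := s0)).exists_bound_of_continuousOn hc.continuousOn
    exact ⟨M, fun s hs => (le_abs_self _).trans (hM s hs)⟩
  have hM0 : 0 ≤ M := le_trans (by positivity) (hM 0 ⟨le_rfl, hs0.le⟩)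
  set w0 := (s0 / 2) ^ (-(1:ℝ) / 4) with hw0
  set D3 := (M * (w0 ^ 2 + w0) + M * (1/2 * w0 ^ 6 + 1/4 * w0 ^ 5)) * (6 + C1 * √s0)
     + (M * (w0 ^ 2 + w0) + 2 * M * (1/2 * w0 ^ 6 + 1/4 * w0 ^ 5)
        + M * (3/4 * w0 ^ 10 + 5/16 * w0 ^ 9)) * (4 * s0 + C1 * s0 * √s0)
      + C1 * (M * (w0 ^ 2 + w0))
      + C1 * √s0 * (M * (w0 ^ 2 + w0) + M * (1/2 * w0 ^ 6 + 1/4 * w0 ^ 5)) with hD3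
  have hD30 : 0 ≤ D3 := by positivity
  refine ⟨D2 + D3, by positivity, fun e he => ?_⟩
  set w : ℝ → ℝ := fun s => (s + e) ^ (-(1:ℝ) / 4) with hw
  have hwpos : ∀ s, 0 ≤ s → 0 < w s := fun s hs => rpow_pos_of_pos (by linarith) _
  have hw4 : ∀ s, 0 ≤ s → (s + e) * w s ^ 4 = 1 := by
    intro s hs
    have hp : 0 < s + e := by linarith
    rw [hw]; simp only
    rw [← rpow_w hp 4]
    norm_num
    rw [rpow_neg_one, mul_inv_cancel₀ hp.ne']
  have hwd : ∀ s, 0 ≤ s → HasDerivAt w (-(1/4) * w s ^ 5) s := by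
    intro s hs
    have hp : 0 < s + e := by linarith
    have h1 : HasDerivAt (fun s : ℝ => s + e) 1 s := (hasDerivAt_id s).add_const e
    have := h1.rpow_const (p := -(1:ℝ)/4) (Or.inl hp.ne')
    convert this using 1
    rw [hw]; simp only
    rw [← rpow_w hp 5]; norm_num
  have hwc : ∀ s, 0 ≤ s → ContDiffAt ℝ (⊤ : ℕ∞) w s := by
    intro s hs
    have hp : 0 < s + e := by linarith
    have h1 : ContDiffAt ℝ (⊤ : ℕ∞) (fun s : ℝ => s + e) s := by fun_prop
    exact h1.rpow_const_of_ne hp.ne'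
  refine ⟨fun s => χ s * (w s ^ 2 + w s),
    fun s => deriv χ s * (w s ^ 2 + w s) + χ s * (-(1/2 * w s ^ 6 + 1/4 * w s ^ 5)),
    fun s => deriv (deriv χ) s * (w s ^ 2 + w s) + 2 * deriv χ s * (-(1/2 * w s ^ 6 + 1/4 * w s ^ 5))
        + χ s * (3/4 * w s ^ 10 + 5/16 * w s ^ 9), ?_, ?_, ?_, ?_, ?_, ?_⟩
  · intro s hs
    exact hχc.contDiffAt.mul (((hwc s hs).pow 2).add (hwc s hs))
  · intro s hs
    have h := (hd1 s).mul (((hwd s hs).pow 2).add (hwd s hs))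
    refine HasDerivAt.congr_deriv h ?_
    simp only [Pi.add_apply, Pi.pow_apply, Pi.neg_apply, Pi.mul_apply, Nat.cast_ofNat]
    ring
  · intro s hs
    have h := ((hd2 s).mul (((hwd s hs).pow 2).add (hwd s hs))).add
      ((hd1 s).mul ((((hwd s hs).pow 6).const_mul (1/2)).add (((hwd s hs).pow 5).const_mul (1/4))).neg)
    refine HasDerivAt.congr_deriv h ?_
    simp only [Pi.add_apply, Pi.pow_apply, Pi.neg_apply, Pi.mul_apply, Nat.cast_ofNat]
    ring
  · intro s hs
    have := smoothTransition.nonneg (2 - 2 * s / s0)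
    have := hwpos s hs
    positivity
  · intro s hs
    have : χ s = 0 := by
      apply smoothTransition.zero_of_nonpos
      have : 2 ≤ 2 * s / s0 := by rw [le_div_iff₀ hs0]; linarith
      linarith
    simp [this]
  · intro s hs X Y hX hY0 hY
    have hp : 0 < s + e := by linarith
    have hwp := hwpos s hs
    rcases lt_or_ge s (s0 / 2) with h | h
    · obtain ⟨c0, c1, c2⟩ := hlow s h
      simp only [c0, c1, c2, if_pos h]
      have h10 : (s + e) ^ (-(10:ℝ)/4) = w s ^ 10 := by
        have := rpow_w hp 10; push_cast at this; rw [this]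
      rw [h10]
      have hsq : √s * w s ^ 2 ≤ 1 := by
        have h1 : √s ^ 2 ≤ s + e := by rw [sq_sqrt hs]; linarith
        have h2 : (√s * w s ^ 2) ^ 2 ≤ 1 := by
          have : (√s * w s ^ 2) ^ 2 = √s ^ 2 * w s ^ 4 := by ring
          rw [this, ← hw4 s hs]; gcongr
        exact (sq_le_one_iff₀ (by positivity)).1 h2
      have := inner_ineq hC1 hwp he hs (hw4 s hs) (sqrt_nonneg s) hsq hX hY (hD (w s) hwp)
      have ha : |0 * (w s ^ 2 + w s) + 1 * (-(1/2 * w s ^ 6 + 1/4 * w s ^ 5))|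
          = 1/2 * w s ^ 6 + 1/4 * w s ^ 5 := by
        rw [zero_mul, one_mul, zero_add, abs_neg, abs_of_pos (by positivity)]
      rw [ha]
      linarith
    · rw [if_neg h.not_gt]
      rcases le_or_gt s s0 with h' | h'
      · have hMs := hM s ⟨hs, h'⟩
        have hww : w s ≤ w0 := by
          apply rpow_le_rpow_of_nonpos (by positivity) (by linarith) (by norm_num)
        have b0 := abs_nonneg (χ s)
        have b1 := abs_nonneg (deriv χ s)
        have b2 := abs_nonneg (deriv (deriv χ) s)
        have := outer_ineq hC1 hM0 hwp hww hs h' hX hY0 hY (c := χ s) (c1 := deriv χ s)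
          (c2 := deriv (deriv χ) s) (by linarith) (by linarith) (by linarith)
        simp only
        linarith
      · obtain ⟨c0, c1, c2⟩ := hhigh s h'
        simp only [c0, c1, c2]
        simp
        positivity


lemma sm_pd {v : E3 → ℝ} (hv : ContDiff ℝ (⊤ : ℕ∞) v) (i : Fin 3) :
    ContDiff ℝ (⊤ : ℕ∞) (pd i v) := by
  have h := (contDiff_infty_iff_fderiv (𝕜 := ℝ) (f := v)).1 hv
  exact h.2.clm_apply contDiff_const

lemma sm_da {v : E3 → ℝ} (hv : ContDiff ℝ (⊤ : ℕ∞) v) (x : E3) : DifferentiableAt ℝ v x :=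
  hv.differentiable (by simp) x

lemma pd_add {v w : E3 → ℝ} (hv : ContDiff ℝ (⊤ : ℕ∞) v) (hw : ContDiff ℝ (⊤ : ℕ∞) w)
    (i : Fin 3) (x : E3) : pd i (fun y => v y + w y) x = pd i v x + pd i w x := by
  simp only [pd]
  rw [fderiv_fun_add (sm_da hv x) (sm_da hw x)]; rfl

lemma pd_sub {v w : E3 → ℝ} (hv : ContDiff ℝ (⊤ : ℕ∞) v) (hw : ContDiff ℝ (⊤ : ℕ∞) w)
    (i : Fin 3) (x : E3) : pd i (fun y => v y - w y) x = pd i v x - pd i w x := by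
  simp only [pd]
  rw [fderiv_fun_sub (sm_da hv x) (sm_da hw x)]; rfl

lemma pd_mul {v w : E3 → ℝ} (hv : ContDiff ℝ (⊤ : ℕ∞) v) (hw : ContDiff ℝ (⊤ : ℕ∞) w)
    (i : Fin 3) (x : E3) : pd i (fun y => v y * w y) x = pd i v x * w x + v x * pd i w x := by
  simp only [pd]
  rw [fderiv_fun_mul (sm_da hv x) (sm_da hw x)]
  simp; ring

lemma pd_const (c : ℝ) (i : Fin 3) (x : E3) : pd i (fun _ => c) x = 0 := by
  simp [pd]

lemma pd_sum {ι : Type*} (s : Finset ι) {v : ι → E3 → ℝ} (hv : ∀ j, ContDiff ℝ (⊤ : ℕ∞) (v j))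
    (i : Fin 3) (x : E3) : pd i (fun y => ∑ j ∈ s, v j y) x = ∑ j ∈ s, pd i (v j) x := by
  simp only [pd]
  rw [fderiv_fun_sum (fun j _ => sm_da (hv j) x)]
  simp

lemma pd_comm {v : E3 → ℝ} (hv : ContDiff ℝ (⊤ : ℕ∞) v) (i j : Fin 3) :
    pd i (pd j v) = pd j (pd i v) := by
  have h := (contDiff_infty_iff_fderiv (𝕜 := ℝ) (f := v)).1 hv
  have hs : ∀ x, IsSymmSndFDerivAt ℝ v x := fun x =>
    hv.contDiffAt.isSymmSndFDerivAt (by simp; exact WithTop.coe_le_coe.2 le_top)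
  have key : ∀ (i j : Fin 3) (x : E3), pd i (pd j v) x =
      fderiv ℝ (fderiv ℝ v) x (EuclideanSpace.single i 1) (EuclideanSpace.single j 1) := by
    intro i j x
    have : DifferentiableAt ℝ (fderiv ℝ v) x := h.2.differentiable (by simp) x
    have h2 : fderiv ℝ (fun y => fderiv ℝ v y (EuclideanSpace.single j (1:ℝ))) x
        = (fderiv ℝ (fderiv ℝ v) x).flip (EuclideanSpace.single j 1) := by
      rw [fderiv_clm_apply this (differentiableAt_const _)]
      simp
    change fderiv ℝ (fun y => fderiv ℝ v y (EuclideanSpace.single j (1:ℝ))) x _ = _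
    rw [h2]; rfl
  ext x
  rw [key, key, hs x]

lemma integral_pd {v : E3 → ℝ} (hv : ContDiff ℝ (⊤ : ℕ∞) v) (hc : HasCompactSupport v)
    (i : Fin 3) : ∫ x, pd i v x = 0 := by
  have hcs : HasCompactSupport (pd i v) := hc.fderiv_apply (𝕜 := ℝ) _
  have i1 : Integrable (fun x => (1:ℝ) * fderiv ℝ v x (EuclideanSpace.single i (1:ℝ)))
      (volume : Measure E3) := by
    simp only [one_mul]
    exact (sm_pd hv i).continuous.integrable_of_hasCompactSupport hcs
  have i2 : Integrable (fun x => (1:ℝ) * v x) (volume : Measure E3) := by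
    simp only [one_mul]
    exact hv.continuous.integrable_of_hasCompactSupport hc
  have := integral_mul_fderiv_eq_neg_fderiv_mul_of_integrable (μ := (volume : Measure E3))
    (f := fun _ : E3 => (1:ℝ)) (g := v) (v := EuclideanSpace.single i (1:ℝ)) (by simp)
    i1 i2 (fun x _ => differentiableAt_const _) (fun x _ => sm_da hv x)
  simpa [pd] using this

/-- Hessian as an array -/
def hs (u : E3 → ℝ) (x : E3) : Fin 3 → Fin 3 → ℝ := fun i j => pd i (pd j u) x

section Calculus
variable {u : E3 → ℝ}

lemma sm_hs (hu : ContDiff ℝ (⊤ : ℕ∞) u) (i j : Fin 3) :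
    ContDiff ℝ (⊤ : ℕ∞) (fun x => hs u x i j) := sm_pd (sm_pd hu j) i

lemma sm_tA (hu : ContDiff ℝ (⊤ : ℕ∞) u) : ContDiff ℝ (⊤ : ℕ∞) (fun x => tA (hs u x)) :=
  ContDiff.sum fun i _ => sm_hs hu i i

lemma sm_fA (hu : ContDiff ℝ (⊤ : ℕ∞) u) : ContDiff ℝ (⊤ : ℕ∞) (fun x => fA (hs u x)) := by
  unfold fA
  exact (((sm_tA hu).pow 2).sub (ContDiff.sum fun i _ => ContDiff.sum fun j _ =>
    (sm_hs hu i j).pow 2)).div_const 2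

lemma sm_sA (hu : ContDiff ℝ (⊤ : ℕ∞) u) (i j : Fin 3) :
    ContDiff ℝ (⊤ : ℕ∞) (fun x => sA (hs u x) i j) := by
  unfold sA
  refine ContDiff.sub ?_ (sm_hs hu i j)
  by_cases h : i = j
  · simpa [h] using sm_tA hu
  · simpa [h] using contDiff_const

lemma hs_symm (hu : ContDiff ℝ (⊤ : ℕ∞) u) (x : E3) (i j : Fin 3) : hs u x i j = hs u x j i := by
  unfold hs; rw [pd_comm hu]

lemma sA_symm (hu : ContDiff ℝ (⊤ : ℕ∞) u) (x : E3) (i j : Fin 3) :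
    sA (hs u x) i j = sA (hs u x) j i := by
  unfold sA; rw [hs_symm hu x i j]; simp [eq_comm]

/-- third derivatives -/
def h3 (u : E3 → ℝ) (x : E3) (k : Fin 3) : Fin 3 → Fin 3 → ℝ := fun i j => pd k (pd i (pd j u)) x

lemma pd_tA (hu : ContDiff ℝ (⊤ : ℕ∞) u) (x : E3) (k : Fin 3) :
    pd k (fun x => tA (hs u x)) x = tA (h3 u x k) := by
  unfold tA
  rw [pd_sum _ (fun j => sm_hs hu j j)]
  rfl

lemma pd_sA (hu : ContDiff ℝ (⊤ : ℕ∞) u) (x : E3) (k i j : Fin 3) :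
    pd k (fun x => sA (hs u x) i j) x = sA (h3 u x k) i j := by
  unfold sA
  by_cases h : i = j
  · simp only [h, if_true]
    rw [pd_sub (sm_tA hu) (sm_hs hu j j), pd_tA hu]; rfl
  · simp only [h, if_false]
    rw [pd_sub contDiff_const (sm_hs hu i j), pd_const]; rfl

lemma div_sA (hu : ContDiff ℝ (⊤ : ℕ∞) u) (x : E3) (j : Fin 3) :
    ∑ i, pd i (fun x => sA (hs u x) i j) x = 0 := by
  simp only [pd_sA hu]
  have e : ∀ i, h3 u x i i j = h3 u x j i i := by
    intro i
    unfold h3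
    rw [pd_comm hu i j, pd_comm (sm_pd hu i) i j]
  have : ∀ i, sA (h3 u x i) i j = (if i = j then tA (h3 u x j) else 0) - h3 u x j i i := by
    intro i
    unfold sA
    rw [e]
    by_cases h : i = j <;> simp [h]
  simp [this, tA]

lemma pd_fA (hu : ContDiff ℝ (⊤ : ℕ∞) u) (x : E3) (k : Fin 3) :
    pd k (fun x => fA (hs u x)) x = ∑ i, ∑ j, sA (hs u x) i j * h3 u x k i j := by
  have e : (fun x => fA (hs u x)) = fun x => (1/2) * ((tA (hs u x) * tA (hs u x)) -
      ∑ i, ∑ j, hs u x i j * hs u x i j) := by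
    ext x; unfold fA; simp only [sq]; ring
  have s1 : ContDiff ℝ (⊤ : ℕ∞) fun x => ∑ i, ∑ j, hs u x i j * hs u x i j :=
    ContDiff.sum fun i _ => ContDiff.sum fun j _ => (sm_hs hu i j).mul (sm_hs hu i j)
  rw [e, pd_mul contDiff_const (((sm_tA hu).mul (sm_tA hu)).sub s1), pd_const,
    pd_sub ((sm_tA hu).mul (sm_tA hu)) s1, pd_mul (sm_tA hu) (sm_tA hu), pd_tA hu,
    pd_sum _ (fun i => ContDiff.sum fun j _ => (sm_hs hu i j).mul (sm_hs hu i j))]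
  have e2 : ∀ i, pd k (fun x => ∑ j, hs u x i j * hs u x i j) x =
      ∑ j, 2 * (hs u x i j * h3 u x k i j) := by
    intro i
    rw [pd_sum _ (fun j => (sm_hs hu i j).mul (sm_hs hu i j))]
    refine Finset.sum_congr rfl fun j _ => ?_
    rw [pd_mul (sm_hs hu i j) (sm_hs hu i j)]
    change h3 u x k i j * _ + _ * h3 u x k i j = _
    ring
  simp only [e2]
  simp [sA, tA, Fin.sum_univ_three]; ring

lemma lap_fA (hu : ContDiff ℝ (⊤ : ℕ∞) u) (x : E3) :
    ∑ k, pd k (pd k (fun x => fA (hs u x))) x =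
      ∑ i, ∑ j, sA (hs u x) i j * pd i (pd j (fun x => tA (hs u x))) x
      + ∑ k, (tA (h3 u x k) ^ 2 - ∑ i, ∑ j, h3 u x k i j ^ 2) := by
  have sm3 : ∀ k i j, ContDiff ℝ (⊤ : ℕ∞) (fun x => h3 u x k i j) := fun k i j =>
    sm_pd (sm_hs hu i j) k
  have e1 : ∀ k, pd k (pd k (fun x => fA (hs u x))) x =
      ∑ i, ∑ j, (sA (h3 u x k) i j * h3 u x k i j
        + sA (hs u x) i j * pd k (pd k (pd i (pd j u))) x) := by
    intro k
    have : pd k (fun x => fA (hs u x)) = fun x => ∑ i, ∑ j, sA (hs u x) i j * h3 u x k i j :=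
      funext fun x => pd_fA hu x k
    rw [this, pd_sum _ (fun i => ContDiff.sum fun j _ => (sm_sA hu i j).mul (sm3 k i j))]
    refine Finset.sum_congr rfl fun i _ => ?_
    rw [pd_sum _ (fun j => (sm_sA hu i j).mul (sm3 k i j))]
    refine Finset.sum_congr rfl fun j _ => ?_
    rw [pd_mul (sm_sA hu i j) (sm3 k i j), pd_sA hu]
    rfl
  have e2 : ∀ i j, pd i (pd j (fun x => tA (hs u x))) x = ∑ k, pd k (pd k (pd i (pd j u))) x := by
    intro i j
    have : pd j (fun x => tA (hs u x)) = fun x => ∑ k, h3 u x j k k :=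
      funext fun x => pd_tA hu x j
    rw [this, pd_sum _ (fun k => sm3 j k k)]
    refine Finset.sum_congr rfl fun k _ => ?_
    change pd i (pd j (pd k (pd k u))) x = _
    rw [pd_comm (sm_pd hu k) j k, pd_comm hu j k, pd_comm (sm_pd (sm_pd hu j) k) i k,
      pd_comm (sm_pd hu j) i k]
  simp only [e1, e2]
  simp only [sA, tA, Fin.sum_univ_three]
  simp
  ring

lemma div_identity (hu : ContDiff ℝ (⊤ : ℕ∞) u) {η : E3 → ℝ} (hη : ContDiff ℝ (⊤ : ℕ∞) η)
    (hc : HasCompactSupport η) :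
    ∫ x, (tA (hs u x) * (∑ i, ∑ j, sA (hs u x) i j * pd i (pd j η) x)
      + η x * (∑ k, (tA (h3 u x k) ^ 2 - ∑ i, ∑ j, h3 u x k i j ^ 2))
      + ∑ k, pd k η x * pd k (fun x => fA (hs u x)) x) = 0 := by
  set b : E3 → ℝ := fun x => tA (hs u x) with hb
  set F : E3 → ℝ := fun x => fA (hs u x) with hF
  have sb : ContDiff ℝ (⊤ : ℕ∞) b := sm_tA hu
  have sF : ContDiff ℝ (⊤ : ℕ∞) F := sm_fA hu
  set V : Fin 3 → E3 → ℝ := fun i x =>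
    ∑ j, sA (hs u x) i j * (b x * pd j η x - η x * pd j b x) + η x * pd i F x with hV
  have sW : ∀ j, ContDiff ℝ (⊤ : ℕ∞) (fun x => b x * pd j η x - η x * pd j b x) := fun j =>
    (sb.mul (sm_pd hη j)).sub (hη.mul (sm_pd sb j))
  have sV1 : ∀ i, ContDiff ℝ (⊤ : ℕ∞) (fun x => ∑ j, sA (hs u x) i j * (b x * pd j η x - η x * pd j b x)) :=
    fun i => ContDiff.sum fun j _ => (sm_sA hu i j).mul (sW j)
  have sV : ∀ i, ContDiff ℝ (⊤ : ℕ∞) (V i) := fun i => (sV1 i).add (hη.mul (sm_pd sF i))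
  have cV : ∀ i, HasCompactSupport (V i) := by
    intro i
    refine hc.mono' ?_
    intro x hx
    by_contra hx'
    apply hx
    have h0 : η =ᶠ[nhds x] fun _ => 0 := by
      rw [notMem_tsupport_iff_eventuallyEq] at hx'; exact hx'
    have h1 : ∀ j, pd j η x = 0 := by
      intro j; simp only [pd]; rw [h0.fderiv_eq]; simp
    simp [hV, h1, h0.eq_of_nhds]
  have key : ∀ x, ∑ i, pd i (V i) x = (tA (hs u x) * (∑ i, ∑ j, sA (hs u x) i j * pd i (pd j η) x)
      + η x * (∑ k, (tA (h3 u x k) ^ 2 - ∑ i, ∑ j, h3 u x k i j ^ 2))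
      + ∑ k, pd k η x * pd k (fun x => fA (hs u x)) x) := by
    intro x
    have e1 : ∀ i, pd i (V i) x = ∑ j, (pd i (fun x => sA (hs u x) i j) x * (b x * pd j η x - η x * pd j b x)
        + sA (hs u x) i j * (pd i b x * pd j η x + b x * pd i (pd j η) x
          - (pd i η x * pd j b x + η x * pd i (pd j b) x)))
        + (pd i η x * pd i F x + η x * pd i (pd i F) x) := by
      intro i
      rw [hV]
      rw [pd_add (sV1 i) (hη.mul (sm_pd sF i)), pd_mul hη (sm_pd sF i),
        pd_sum _ (fun j => (sm_sA hu i j).mul (sW j))]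
      congr 1
      refine Finset.sum_congr rfl fun j _ => ?_
      rw [pd_mul (sm_sA hu i j) (sW j), pd_sub (sb.mul (sm_pd hη j)) (hη.mul (sm_pd sb j)),
        pd_mul sb (sm_pd hη j), pd_mul hη (sm_pd sb j)]
    have d0 := div_sA hu x 0
    have d1 := div_sA hu x 1
    have d2 := div_sA hu x 2
    have l := lap_fA hu x
    obtain ⟨s1, s2, s3⟩ := sym3 (sA_symm hu x)
    simp only [e1]
    rw [← hb, ← hF] at l
    have hbx : tA (hs u x) = b x := rfl
    rw [hbx, ← hF]
    set T := ∑ k, (tA (h3 u x k) ^ 2 - ∑ i, ∑ j, h3 u x k i j ^ 2)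
    simp only [Fin.sum_univ_three, s1, s2, s3] at d0 d1 d2 l ⊢
    linear_combination (b x * pd 0 η x - η x * pd 0 b x) * d0 +
      (b x * pd 1 η x - η x * pd 1 b x) * d1 + (b x * pd 2 η x - η x * pd 2 b x) * d2 + η x * l
  calc _ = ∫ x, ∑ i, pd i (V i) x := by simp only [key, hF]
    _ = ∑ i, ∫ x, pd i (V i) x := integral_finsetSum _ fun i _ =>
        (sm_pd (sV i) i).continuous.integrable_of_hasCompactSupport ((cV i).fderiv_apply (𝕜 := ℝ) _)
    _ = 0 := by simp [integral_pd (sV _) (cV _)]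

end Calculus


set_option maxHeartbeats 1600000 in
lemma pointwise_alg {K CL CF f0 s C1 e1 e2 X0 Y0 φ φ1 φ2 B : ℝ} (hK : 1 ≤ K) (hCL : 0 ≤ CL) (hCF : 0 ≤ CF)
    (H : Fin 3 → Fin 3 → ℝ) (hsy : ∀ i j, H i j = H j i) (ht : 0 < tA H)
    (hF : 1 / K ≤ fA H) (hf0 : 1 / K ≤ f0) (hf0' : f0 ≤ K)
    (z q Fk : Fin 3 → ℝ) (X3 : Fin 3 → Fin 3 → Fin 3 → ℝ)
    (hX3 : ∀ k, ∑ i, ∑ j, sA H i j * X3 k i j = Fk k)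
    (hs : s = f0 * ∑ i, z i ^ 2 + ∑ i, q i ^ 2)
    (hFf : |fA H - f0| ≤ CL * √s) (hFk : ∀ k, |Fk k| ≤ CF * tA H)
    (hC1 : C1 = (3 * K / 2) * ((4 * CL + 6 * CF) + 8 * CL + 3 / 2 * K * CF ^ 2 + 6 * (K ^ 3 + 3) * CF))
    (hX0 : X0 = ∑ i, ∑ j, sA H i j * ((if i = j then 2 * f0 else 0) + 2 * ∑ k, H k i * H k j)
        + 2 * ∑ k, q k * Fk k)
    (hY0 : Y0 = 4 * ∑ i, ∑ j, sA H i j * (f0 * z i + ∑ k, q k * H k i) * (f0 * z j + ∑ k, q k * H k j))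
    (he1 : e1 = ∑ k, (tA (X3 k) ^ 2 - ∑ i, ∑ j, X3 k i j ^ 2))
    (he2 : e2 = ∑ k, (φ1 * (2 * (f0 * z k + ∑ l, q l * H l k))) * Fk k)
    (hφ : 0 ≤ φ)
    (hmain : ∀ X Y : ℝ, |X - 6| ≤ C1 * √s → 0 ≤ Y → Y ≤ 4 * s + C1 * s * √s →
      φ1 * X + φ2 * Y + C1 * φ + C1 * √s * |φ1| ≤ B) :
    tA H * (φ2 * Y0 + φ1 * X0) + φ * e1 + e2 ≤ tA H * wA H * B := by
  have hK0 : 0 < K := by linarith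
  have hF0 : 0 < fA H := lt_of_lt_of_le (by positivity) hF
  have hf00 : 0 < f0 := lt_of_lt_of_le (by positivity) hf0
  have hw := wA_lower H hsy ht hF0
  set t := tA H with htd
  set W := wA H
  set r := √s with hr
  have hr0 : 0 ≤ r := sqrt_nonneg s
  have hs0 : 0 ≤ s := by rw [hs]; positivity
  have htW : t ≤ 3 * K / 2 * W := by
    have : 2 / 3 * (1 / K) * t ≤ W := le_trans (by gcongr) hw
    have h2 : 3 * K / 2 * (2 / 3 * (1 / K) * t) = t := by field_simp
    rw [← h2]; gcongr
  have hW : 0 < W := by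
    by_contra h
    have : 3 * K / 2 * W ≤ 0 := mul_nonpos_of_nonneg_of_nonpos (by positivity) (not_lt.1 h)
    linarith
  have hKt : 1 ≤ K * t := by
    have h1 : 2 * fA H ≤ t ^ 2 := by
      have : 0 ≤ ∑ i, ∑ j, H i j ^ 2 := by positivity
      unfold fA; rw [← htd]; linarith
    have h2 : 1 ≤ K * fA H := by
      have := mul_le_mul_of_nonneg_left hF hK0.le
      rwa [mul_one_div_cancel hK0.ne'] at this
    by_contra h
    have h3 : (K * t) ^ 2 < 1 := by
      have : 0 < K * t := by positivity
      nlinarith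
    nlinarith
  have hq : ∀ k, |q k| ≤ r := by
    intro k
    apply abs_le_sqrt
    rw [hs]
    have h1 := Finset.single_le_sum (f := fun i => q i ^ 2) (fun i _ => by positivity) (Finset.mem_univ k)
    have h2 : 0 ≤ f0 * ∑ i, z i ^ 2 := by positivity
    linarith
  have hz : ∀ k, |z k| ≤ K * r := by
    intro k
    have h1 := Finset.single_le_sum (f := fun i => z i ^ 2) (fun i _ => by positivity) (Finset.mem_univ k)
    have h2 : 0 ≤ ∑ i, q i ^ 2 := by positivity
    have h3 : 1 / K * z k ^ 2 ≤ s := by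
      have : 1 / K * z k ^ 2 ≤ f0 * ∑ i, z i ^ 2 := by gcongr
      linarith
    have h4 : z k ^ 2 ≤ K * s := by
      have := mul_le_mul_of_nonneg_left h3 hK0.le
      rw [← mul_assoc, mul_one_div_cancel hK0.ne', one_mul] at this
      exact this
    apply abs_le_of_sq_le_sq _ (by positivity)
    rw [mul_pow, hr, sq_sqrt hs0]
    nlinarith
  have hH : ∀ i j, |H i j| ≤ t := entry_le H ht hF0
  -- X estimate
  have hX : |X0 - 6 * W| ≤ (4 * CL + 6 * CF) * r * t := by
    rw [hX0, wA_trace H hsy]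
    have e : 6 * wA H + 4 * (f0 - fA H) * tA H + 2 * ∑ k, q k * Fk k - 6 * W
        = 4 * (f0 - fA H) * t + 2 * ∑ k, q k * Fk k := by ring
    rw [e]
    have h1 : |4 * (f0 - fA H) * t| ≤ 4 * (CL * r) * t := by
      rw [abs_mul, abs_mul, abs_of_pos ht, abs_sub_comm, abs_of_pos (show (0:ℝ) < 4 by norm_num)]
      gcongr
    have h2 : |2 * ∑ k, q k * Fk k| ≤ 2 * (3 * (r * (CF * t))) := by
      rw [abs_mul, abs_two]
      gcongr
      refine (Finset.abs_sum_le_sum_abs _ _).trans ?_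
      refine (Finset.sum_le_sum (g := fun _ => r * (CF * t)) fun k _ => ?_).trans (by simp)
      rw [abs_mul]
      exact mul_le_mul (hq k) (hFk k) (abs_nonneg _) hr0
    refine (abs_add_le _ _).trans ?_
    linarith
  have hY00 : 0 ≤ Y0 := by
    rw [hY0]
    have := sA_nonneg H ht hF0 (fun i => f0 * z i + ∑ k, q k * H k i)
    positivity
  have hY : Y0 ≤ 4 * s * W + 8 * CL * r * t * s := by
    have := grad_bound H hsy ht hF0 hf00 z q
    rw [← hs] at this
    have h1 : (W + 2 * |fA H - f0| * t) * s ≤ (W + 2 * (CL * r) * t) * s := by gcongr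
    rw [hY0]
    linarith
  have he1' : e1 ≤ 3 / 2 * K * CF ^ 2 * t ^ 2 := by
    rw [he1]
    refine (Finset.sum_le_sum (g := fun _ => 1 / 2 * K * CF ^ 2 * t ^ 2) fun k _ => ?_).trans ?_
    · refine (reverse_cs H (X3 k) hF0).trans ?_
      rw [hX3 k, div_le_iff₀ (by positivity)]
      have h1 : Fk k ^ 2 ≤ (CF * t) ^ 2 := sq_le_sq' (abs_le.1 (hFk k)).1 (abs_le.1 (hFk k)).2
      have h2 : 1 ≤ K * fA H := by
        have := mul_le_mul_of_nonneg_left hF hK0.le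
        rwa [mul_one_div_cancel hK0.ne'] at this
      have h3 : (CF * t) ^ 2 * 1 ≤ (CF * t) ^ 2 * (K * fA H) := by gcongr
      nlinarith
    · simp; linarith
  have he2' : e2 ≤ |φ1| * (6 * (K ^ 3 + 3) * CF * r * t ^ 2) := by
    rw [he2]
    refine (Finset.sum_le_sum (g := fun _ => |φ1| * (2 * (K ^ 3 + 3) * CF * r * t ^ 2)) fun k _ => ?_).trans ?_
    · refine (le_abs_self _).trans ?_
      rw [abs_mul, abs_mul]
      have h1 : |2 * (f0 * z k + ∑ l, q l * H l k)| ≤ 2 * ((K ^ 3 + 3) * r * t) := by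
        rw [abs_mul, abs_two]
        gcongr
        refine (abs_add_le _ _).trans ?_
        have a1 : |f0 * z k| ≤ K ^ 3 * r * t := by
          rw [abs_mul, abs_of_pos hf00]
          calc f0 * |z k| ≤ K * (K * r) := mul_le_mul hf0' (hz k) (abs_nonneg _) hK0.le
            _ = K * K * r * 1 := by ring
            _ ≤ K * K * r * (K * t) := by gcongr
            _ = _ := by ring
        have a2 : |∑ l, q l * H l k| ≤ 3 * (r * t) := by
          refine (Finset.abs_sum_le_sum_abs _ _).trans ?_
          refine (Finset.sum_le_sum (g := fun _ => r * t) fun l _ => ?_).trans (by simp)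
          rw [abs_mul]
          exact mul_le_mul (hq l) (hH l k) (abs_nonneg _) hr0
        linarith
      calc _ ≤ |φ1| * (2 * ((K ^ 3 + 3) * r * t)) * (CF * t) := by
            gcongr
            exact hFk k
        _ = _ := by ring
    · simp; linarith
  have hm := hmain (X0 / W) (Y0 / W) ?_ (by positivity) ?_
  · have h1 := mul_le_mul_of_nonneg_left hm (show 0 ≤ t * W by positivity)
    have h2 : t * W * (φ1 * (X0 / W) + φ2 * (Y0 / W) + C1 * φ + C1 * r * |φ1|) =
        t * (φ2 * Y0 + φ1 * X0) + φ * (t * (W * C1)) + |φ1| * (r * (t * (W * C1))) := by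
      field_simp; ring
    rw [h2] at h1
    have hC : t * ((4 * CL + 6 * CF) + 8 * CL + 3 / 2 * K * CF ^ 2 + 6 * (K ^ 3 + 3) * CF) ≤ W * C1 := by
      rw [hC1]
      calc _ ≤ (3 * K / 2 * W) * ((4 * CL + 6 * CF) + 8 * CL + 3 / 2 * K * CF ^ 2 + 6 * (K ^ 3 + 3) * CF) := by gcongr
        _ = _ := by ring
    have c1 : 3 / 2 * K * CF ^ 2 * t ≤ W * C1 := by
      refine le_trans ?_ hC
      have : 0 ≤ t * ((4 * CL + 6 * CF) + 8 * CL + 6 * (K ^ 3 + 3) * CF) := by positivity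
      linarith
    have c2 : 6 * (K ^ 3 + 3) * CF * t ≤ W * C1 := by
      refine le_trans ?_ hC
      have : 0 ≤ t * ((4 * CL + 6 * CF) + 8 * CL + 3 / 2 * K * CF ^ 2) := by positivity
      linarith
    have d1 : φ * e1 ≤ φ * (t * (W * C1)) := by
      refine mul_le_mul_of_nonneg_left (he1'.trans ?_) hφ
      have := mul_le_mul_of_nonneg_left c1 ht.le
      linarith
    have d2 : e2 ≤ |φ1| * (r * (t * (W * C1))) := by
      refine he2'.trans (mul_le_mul_of_nonneg_left ?_ (abs_nonneg _))
      have := mul_le_mul_of_nonneg_left c2 (mul_nonneg hr0 ht.le)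
      linarith
    linarith
  · have : X0 / W - 6 = (X0 - 6 * W) / W := by field_simp
    rw [this, abs_div, abs_of_pos hW, div_le_iff₀ hW]
    refine hX.trans ?_
    rw [hC1]
    calc (4 * CL + 6 * CF) * r * t ≤ (4 * CL + 6 * CF) * r * (3 * K / 2 * W) := by gcongr
      _ = (3 * K / 2) * (4 * CL + 6 * CF) * r * W := by ring
      _ ≤ _ := by
        refine mul_le_mul_of_nonneg_right (mul_le_mul_of_nonneg_right (mul_le_mul_of_nonneg_left ?_ (by positivity)) hr0) hW.le
        have : 0 ≤ 8 * CL + 3 / 2 * K * CF ^ 2 + 6 * (K ^ 3 + 3) * CF := by positivity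
        linarith
  · rw [div_le_iff₀ hW]
    refine hY.trans ?_
    have : 8 * CL * r * t * s ≤ C1 * s * r * W := by
      rw [hC1]
      calc 8 * CL * r * t * s ≤ 8 * CL * r * (3 * K / 2 * W) * s := by gcongr
        _ = (3 * K / 2) * (8 * CL) * s * r * W := by ring
        _ ≤ _ := by
          gcongr
          have : 0 ≤ (4 * CL + 6 * CF) + 3 / 2 * K * CF ^ 2 + 6 * (K ^ 3 + 3) * CF := by positivity
          linarith
    linarith


/-- squared distance on the graph of the gradient -/
def gsq (u : E3 → ℝ) (f0 : ℝ) (y x : E3) : ℝ :=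
  f0 * ∑ i, (x i - y i) ^ 2 + ∑ k, (pd k u x - pd k u y) ^ 2

lemma sm_coord (i : Fin 3) : ContDiff ℝ (⊤ : ℕ∞) (fun x : E3 => x i) := by fun_prop

lemma pd_coord (i j : Fin 3) (x : E3) : pd i (fun x : E3 => x j) x = if i = j then 1 else 0 := by
  simp only [pd]
  have : (fun x : E3 => x j) = (EuclideanSpace.proj j : E3 →L[ℝ] ℝ) := by ext; simp
  rw [this, ContinuousLinearMap.fderiv]
  simp [eq_comm]

lemma sm_sq {u : E3 → ℝ} (hu : ContDiff ℝ (⊤ : ℕ∞) u) (f0 : ℝ) (y : E3) :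
    ContDiff ℝ (⊤ : ℕ∞) (gsq u f0 y) := by
  unfold gsq
  refine (contDiff_const.mul (ContDiff.sum fun i _ => ((sm_coord i).sub contDiff_const).pow 2)).add
    (ContDiff.sum fun i _ => ((sm_pd hu i).sub contDiff_const).pow 2)

lemma pd_sq_fun {v : E3 → ℝ} (hv : ContDiff ℝ (⊤ : ℕ∞) v) (c : ℝ) (i : Fin 3) (x : E3) :
    pd i (fun x => (v x - c) ^ 2) x = 2 * (v x - c) * pd i v x := by
  have h := hv.sub (contDiff_const (c := c))
  have e : (fun x => (v x - c) ^ 2) = fun x => (v x - c) * (v x - c) := by ext x; ring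
  rw [e, pd_mul h h, pd_sub hv contDiff_const, pd_const]; ring

lemma pd_sq {u : E3 → ℝ} (hu : ContDiff ℝ (⊤ : ℕ∞) u) (f0 : ℝ) (y x : E3) (i : Fin 3) :
    pd i (gsq u f0 y) x = 2 * (f0 * (x i - y i) + ∑ k, (pd k u x - pd k u y) * hs u x k i) := by
  have s1 : ∀ j : Fin 3, ContDiff ℝ (⊤ : ℕ∞) (fun x : E3 => (x j - y j) ^ 2) :=
    fun j => ((sm_coord j).sub contDiff_const).pow 2
  have s2 : ∀ k : Fin 3, ContDiff ℝ (⊤ : ℕ∞) (fun x : E3 => (pd k u x - pd k u y) ^ 2) :=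
    fun k => ((sm_pd hu k).sub contDiff_const).pow 2
  have e : gsq u f0 y = fun x => f0 * ∑ i, (x i - y i) ^ 2 + ∑ k, (pd k u x - pd k u y) ^ 2 := rfl
  rw [e, pd_add (contDiff_const.mul (ContDiff.sum fun j _ => s1 j)) (ContDiff.sum fun k _ => s2 k),
    pd_mul contDiff_const (ContDiff.sum fun j _ => s1 j), pd_const, pd_sum _ s1, pd_sum _ s2]
  have e1 : ∀ j, pd i (fun x : E3 => (x j - y j) ^ 2) x = 2 * (x j - y j) * (if i = j then 1 else 0) := by
    intro j
    rw [pd_sq_fun (sm_coord j), pd_coord]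
  have e2 : ∀ k, pd i (fun x : E3 => (pd k u x - pd k u y) ^ 2) x =
      2 * ((pd k u x - pd k u y) * hs u x k i) := by
    intro k
    rw [pd_sq_fun (sm_pd hu k), hs_symm hu x k i, mul_assoc]; rfl
  simp only [e1, e2]
  rw [← Finset.mul_sum]
  simp; ring

lemma pd_pd_sq {u : E3 → ℝ} (hu : ContDiff ℝ (⊤ : ℕ∞) u) (f0 : ℝ) (y x : E3) (i j : Fin 3) :
    pd i (pd j (gsq u f0 y)) x = ((if i = j then 2 * f0 else 0) + 2 * ∑ k, hs u x k i * hs u x k j)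
      + 2 * ∑ k, (pd k u x - pd k u y) * h3 u x k i j := by
  have e : pd j (gsq u f0 y) = fun x => 2 * (f0 * (x j - y j) + ∑ k, (pd k u x - pd k u y) * hs u x k j) :=
    funext fun x => pd_sq hu f0 y x j
  have s1 : ContDiff ℝ (⊤ : ℕ∞) (fun x : E3 => x j - y j) := (sm_coord j).sub contDiff_const
  have s2 : ∀ k, ContDiff ℝ (⊤ : ℕ∞) (fun x : E3 => pd k u x - pd k u y) :=
    fun k => (sm_pd hu k).sub contDiff_const
  have s3 : ∀ k, ContDiff ℝ (⊤ : ℕ∞) (fun x : E3 => (pd k u x - pd k u y) * hs u x k j) :=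
    fun k => (s2 k).mul (sm_hs hu k j)
  have s4 : ContDiff ℝ (⊤ : ℕ∞) (fun x : E3 => ∑ k, (pd k u x - pd k u y) * hs u x k j) :=
    ContDiff.sum fun k _ => s3 k
  rw [e, pd_mul contDiff_const ((contDiff_const.mul s1).add s4), pd_const,
    pd_add (contDiff_const.mul s1) s4, pd_mul contDiff_const s1, pd_const,
    pd_sub (sm_coord j) contDiff_const, pd_const, pd_coord, pd_sum _ s3]
  have e2 : ∀ k, pd i (fun x : E3 => (pd k u x - pd k u y) * hs u x k j) x =
      hs u x k i * hs u x k j + (pd k u x - pd k u y) * h3 u x k i j := by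
    intro k
    rw [pd_mul (s2 k) (sm_hs hu k j), pd_sub (sm_pd hu k) contDiff_const, pd_const,
      hs_symm hu x k i]
    have : pd i (fun x => hs u x k j) x = h3 u x k i j := by
      unfold h3
      change pd i (pd k (pd j u)) x = _
      rw [pd_comm (sm_pd hu j) i k]
    rw [this, sub_zero]; rfl
  simp only [e2, Finset.sum_add_distrib]
  by_cases h : i = j <;> simp [h] <;> ring

lemma pd_comp {s : E3 → ℝ} (hs : ContDiff ℝ (⊤ : ℕ∞) s) {φ : ℝ → ℝ} {φ' : ℝ} {x : E3}
    (h : HasDerivAt φ φ' (s x)) (i : Fin 3) : pd i (fun y => φ (s y)) x = φ' * pd i s x := by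
  simp only [pd]
  have := h.comp_hasFDerivAt x (sm_da hs x).hasFDerivAt
  have e := this.fderiv
  change fderiv ℝ (φ ∘ s) x _ = _
  rw [e]; simp

lemma pd_comp_mul {s g : E3 → ℝ} (hs : ContDiff ℝ (⊤ : ℕ∞) s) (hg : ContDiff ℝ (⊤ : ℕ∞) g)
    {φ : ℝ → ℝ} {φ' : ℝ} {x : E3}
    (h : HasDerivAt φ φ' (s x)) (i : Fin 3) :
    pd i (fun y => φ (s y) * g y) x = φ' * pd i s x * g x + φ (s x) * pd i g x := by
  have h1 := (h.comp_hasFDerivAt x (sm_da hs x).hasFDerivAt).mul (sm_da hg x).hasFDerivAt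
  have e := h1.fderiv
  simp only [pd]
  change fderiv ℝ ((φ ∘ s) * g) x _ = _
  rw [e]; simp; ring

lemma sq_nonneg' {u : E3 → ℝ} {f0 : ℝ} (hf0 : 0 < f0) (y x : E3) : 0 ≤ gsq u f0 y x := by
  unfold gsq; positivity

lemma sum_sq_eq (x y : E3) : ∑ i, (x i - y i) ^ 2 = ‖x - y‖ ^ 2 := by
  rw [EuclideanSpace.norm_sq_eq]; simp

lemma sq_ge {u : E3 → ℝ} {f0 : ℝ} (y x : E3) : f0 * ‖x - y‖ ^ 2 ≤ gsq u f0 y x := by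
  unfold gsq; rw [sum_sq_eq]
  have : 0 ≤ ∑ k, (pd k u x - pd k u y) ^ 2 := by positivity
  linarith


/-- reduced hypotheses for a globally smooth function -/
structure Hyp5 (K : ℝ) (f : E3 × ℝ × E3 → ℝ) (u : E3 → ℝ) : Prop where
  hK : 1 ≤ K
  hf2 : ContDiff ℝ 2 f
  hfl : ∀ z, 1 / K ≤ f z
  hfd : ∀ z, ∀ k : ℕ, k ≤ 2 → ‖iteratedFDeriv ℝ k f z‖ ≤ K
  hu : ContDiff ℝ (⊤ : ℕ∞) u
  heq : ∀ x ∈ ball (0 : E3) 5, fA (hs u x) = f (x, u x, grad u x)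
  hlap : ∀ x ∈ ball (0 : E3) 5, 0 < tA (hs u x)
  hbd : ∀ x ∈ ball (0 : E3) 5, |u x| + ‖grad u x‖ ≤ K

lemma fderiv_eq_sum (v : E3 → ℝ) (x z : E3) : fderiv ℝ v x z = ∑ i, z i * pd i v x := by
  have : z = ∑ i, z i • (EuclideanSpace.single i (1:ℝ) : E3) := by
    ext j
    simp [Fin.sum_univ_three]
    fin_cases j <;> simp
  conv_lhs => rw [this]
  rw [map_sum]
  simp [pd]

lemma grad_apply (u : E3 → ℝ) (x : E3) (i : Fin 3) : grad u x i = pd i u x := rfl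

lemma norm_fderiv_le_grad (v : E3 → ℝ) (x : E3) : ‖fderiv ℝ v x‖ ≤ ‖grad v x‖ := by
  refine ContinuousLinearMap.opNorm_le_bound _ (norm_nonneg _) fun z => ?_
  have : fderiv ℝ v x z = inner ℝ (grad v x) z := by
    rw [fderiv_eq_sum, PiLp.inner_apply]
    simp [grad_apply]
  rw [this]
  exact norm_inner_le_norm _ _

section Bounds
variable {K : ℝ} {f : E3 × ℝ × E3 → ℝ} {u : E3 → ℝ}

lemma f_fderiv (h : Hyp5 K f u) (z) : ‖fderiv ℝ f z‖ ≤ K := by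
  have := h.hfd z 1 (by norm_num)
  rwa [norm_iteratedFDeriv_one] at this

lemma f_le (h : Hyp5 K f u) (z) : f z ≤ K := by
  have := h.hfd z 0 (by norm_num)
  rw [norm_iteratedFDeriv_zero] at this
  exact (le_abs_self _).trans this

lemma f_lip (h : Hyp5 K f u) (z z') : |f z - f z'| ≤ K * ‖z - z'‖ :=
  convex_univ.norm_image_sub_le_of_norm_fderiv_le
    (fun x _ => h.hf2.differentiable (by norm_num) x) (fun x _ => f_fderiv h x) (Set.mem_univ z')
    (Set.mem_univ z)

lemma u_lip (h : Hyp5 K f u) {x y : E3} (hx : x ∈ ball (0 : E3) 5) (hy : y ∈ ball (0 : E3) 5) :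
    |u x - u y| ≤ K * ‖x - y‖ :=
  (convex_ball (0 : E3) 5).norm_image_sub_le_of_norm_fderiv_le
    (fun x _ => sm_da h.hu x) (fun x hx => (norm_fderiv_le_grad u x).trans
      (by have := h.hbd x hx; have := abs_nonneg (u x); linarith)) hy hx

lemma F_lip (h : Hyp5 K f u) {x y : E3} (hx : x ∈ ball (0 : E3) 5) (hy : y ∈ ball (0 : E3) 5)
    {f0 : ℝ} (hf0 : f0 = fA (hs u y)) :
    |fA (hs u x) - f0| ≤ K * (K + K ^ 2 + 1) * √(gsq u f0 y x) := by
  have hK := h.hK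
  have hK0 : 0 < K := by linarith
  have hf0l : 1 / K ≤ f0 := by rw [hf0, h.heq y hy]; exact h.hfl _
  have hf0p : 0 < f0 := lt_of_lt_of_le (by positivity) hf0l
  set r := √(gsq u f0 y x) with hr
  have hr0 : 0 ≤ r := sqrt_nonneg _
  have hxy : ‖x - y‖ ≤ K * r := by
    have h1 : ‖x - y‖ ^ 2 ≤ (K * r) ^ 2 := by
      rw [mul_pow, hr, sq_sqrt (sq_nonneg' hf0p y x)]
      have h1 := sq_ge (u := u) (f0 := f0) y x
      have h2 : 1 / K * ‖x - y‖ ^ 2 ≤ f0 * ‖x - y‖ ^ 2 := by gcongr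
      have h3 : K * (1 / K * ‖x - y‖ ^ 2) = ‖x - y‖ ^ 2 := by field_simp
      have h4 := mul_le_mul_of_nonneg_left (h2.trans h1) hK0.le
      have h5 := sq_nonneg' (u := u) hf0p y x
      nlinarith
    exact le_of_sq_le_sq h1 (by positivity)
  have hg : ‖grad u x - grad u y‖ ≤ r := by
    apply le_sqrt_of_sq_le
    rw [EuclideanSpace.norm_sq_eq]
    have : 0 ≤ f0 * ∑ i, (x i - y i) ^ 2 := by positivity
    simp only [PiLp.sub_apply, grad_apply, norm_eq_abs, sq_abs]
    unfold gsq; linarith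
  rw [hf0, h.heq x hx, h.heq y hy]
  refine (f_lip h _ _).trans ?_
  rw [mul_assoc]
  gcongr
  have hu := u_lip h hx hy
  have hu' : |u x - u y| ≤ K * (K * r) := hu.trans (by gcongr)
  have p1 : 0 ≤ K * r := by positivity
  have p2 : 0 ≤ K * (K * r) := by positivity
  rw [Prod.norm_def, Prod.norm_def]
  simp only [Prod.fst_sub, Prod.snd_sub, norm_eq_abs]
  refine max_le ?_ (max_le ?_ ?_) <;> nlinarith

lemma one_le_Kt {K : ℝ} (hK : 1 ≤ K) (H : Fin 3 → Fin 3 → ℝ) (ht : 0 < tA H)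
    (hF : 1 / K ≤ fA H) : 1 ≤ K * tA H := by
  have hK0 : 0 < K := by linarith
  have h1 : 2 * fA H ≤ tA H ^ 2 := by
    have : 0 ≤ ∑ i, ∑ j, H i j ^ 2 := by positivity
    unfold fA; linarith
  have h2 : 1 ≤ K * fA H := by
    have := mul_le_mul_of_nonneg_left hF hK0.le
    rwa [mul_one_div_cancel hK0.ne'] at this
  by_contra h
  have h3 : (K * tA H) ^ 2 < 1 := by
    have : 0 < K * tA H := by positivity
    nlinarith
  nlinarith

lemma F_grad (h : Hyp5 K f u) {x : E3} (hx : x ∈ ball (0 : E3) 5) (k : Fin 3) :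
    |pd k (fun x => fA (hs u x)) x| ≤ K * (K + K ^ 2 + 3) * tA (hs u x) := by
  have hK := h.hK
  have hK0 : 0 < K := by linarith
  have ht := h.hlap x hx
  have hFl : 1 / K ≤ fA (hs u x) := by rw [h.heq x hx]; exact h.hfl _
  have hF0 : 0 < fA (hs u x) := lt_of_lt_of_le (by positivity) hFl
  have hKt := one_le_Kt hK _ ht hFl
  set t := tA (hs u x)
  have hev : (fun x => fA (hs u x)) =ᶠ[nhds x] fun x => f (x, u x, grad u x) := by
    filter_upwards [isOpen_ball.mem_nhds hx] with y hy using h.heq y hy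
  have hgd : DifferentiableAt ℝ (grad u) x := by
    rw [differentiableAt_euclidean]
    intro i
    exact sm_da (sm_pd h.hu i) x
  have hG : HasFDerivAt (fun x => (x, u x, grad u x))
      ((ContinuousLinearMap.id ℝ E3).prod ((fderiv ℝ u x).prod (fderiv ℝ (grad u) x))) x :=
    (hasFDerivAt_id x).prodMk ((sm_da h.hu x).hasFDerivAt.prodMk hgd.hasFDerivAt)
  have hf : HasFDerivAt f (fderiv ℝ f (x, u x, grad u x)) (x, u x, grad u x) :=
    (h.hf2.differentiable (by norm_num) _).hasFDerivAt
  have hcomp := hf.comp x hG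
  have e1 : pd k (fun x => fA (hs u x)) x = fderiv ℝ f (x, u x, grad u x)
      ((EuclideanSpace.single k (1:ℝ) : E3), pd k u x, fderiv ℝ (grad u) x (EuclideanSpace.single k (1:ℝ))) := by
    simp only [pd]
    rw [hev.fderiv_eq]
    change fderiv ℝ (f ∘ fun x => (x, u x, grad u x)) x _ = _
    rw [hcomp.fderiv]; rfl
  have e2 : ∀ j, (fderiv ℝ (grad u) x (EuclideanSpace.single k (1:ℝ))) j = hs u x k j := by
    intro j
    have h1 := ((EuclideanSpace.proj j : E3 →L[ℝ] ℝ).hasFDerivAt (x := grad u x)).comp x hgd.hasFDerivAt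
    have h2 := h1.fderiv
    have h3 : hs u x k j = fderiv ℝ ((EuclideanSpace.proj j : E3 →L[ℝ] ℝ) ∘ grad u) x (EuclideanSpace.single k (1:ℝ)) := rfl
    rw [h3, h2]; rfl
  have n3 : ‖fderiv ℝ (grad u) x (EuclideanSpace.single k (1:ℝ))‖ ≤ 3 * t := by
    refine le_of_sq_le_sq ?_ (by positivity)
    rw [EuclideanSpace.norm_sq_eq]
    simp only [e2, norm_eq_abs, sq_abs]
    refine (Finset.sum_le_sum (g := fun _ => t ^ 2) fun j _ => ?_).trans ?_
    · have := abs_le.1 (entry_le _ ht hF0 k j)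
      exact sq_le_sq' this.1 this.2
    · simp; nlinarith
  have n2 : |pd k u x| ≤ K := by
    have h1 := PiLp.norm_apply_le (grad u x) k
    have h2 := h.hbd x hx
    have := abs_nonneg (u x)
    rw [grad_apply, norm_eq_abs] at h1
    linarith
  rw [e1, ← norm_eq_abs]
  refine (ContinuousLinearMap.le_opNorm _ _).trans ?_
  rw [mul_assoc]
  refine mul_le_mul (f_fderiv h _) ?_ (norm_nonneg _) hK0.le
  have p1 : K ≤ K ^ 2 * t := by nlinarith
  rw [Prod.norm_def, Prod.norm_def]
  simp only [norm_eq_abs (pd k u x), EuclideanSpace.norm_single, norm_one]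
  refine max_le ?_ (max_le ?_ ?_) <;> nlinarith

end Bounds


/-- constant in the differential inequality -/
def CC1 (K : ℝ) : ℝ := (3 * K / 2) * ((4 * (K * (K + K ^ 2 + 1)) + 6 * (K * (K + K ^ 2 + 3)))
  + 8 * (K * (K + K ^ 2 + 1)) + 3 / 2 * K * (K * (K + K ^ 2 + 3)) ^ 2
  + 6 * (K ^ 3 + 3) * (K * (K + K ^ 2 + 3)))

section Main
variable {K : ℝ} {f : E3 × ℝ × E3 → ℝ} {u : E3 → ℝ}

lemma sm_det (hu : ContDiff ℝ (⊤ : ℕ∞) u) :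
    ContDiff ℝ (⊤ : ℕ∞) (fun x => (Matrix.of (hs u x)).det) := by
  simp only [Matrix.det_fin_three, Matrix.of_apply]
  have h := sm_hs hu
  exact (((((((h 0 0).mul (h 1 1)).mul (h 2 2)).sub (((h 0 0).mul (h 1 2)).mul (h 2 1))).sub
    (((h 0 1).mul (h 1 0)).mul (h 2 2))).add (((h 0 1).mul (h 1 2)).mul (h 2 0))).add
    (((h 0 2).mul (h 1 0)).mul (h 2 1))).sub (((h 0 2).mul (h 1 1)).mul (h 2 0))

lemma sm_wA (hu : ContDiff ℝ (⊤ : ℕ∞) u) :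
    ContDiff ℝ (⊤ : ℕ∞) (fun x => wA (hs u x)) :=
  ((sm_fA hu).mul (sm_tA hu)).sub (sm_det hu)

/-- the integrand of the divergence identity -/
def integrand (u η : E3 → ℝ) (x : E3) : ℝ :=
  tA (hs u x) * (∑ i, ∑ j, sA (hs u x) i j * pd i (pd j η) x)
    + η x * (∑ k, (tA (h3 u x k)^2 - ∑ i, ∑ j, h3 u x k i j^2))
    + ∑ k, pd k η x * pd k (fun x => fA (hs u x)) x

lemma cont_integrand (hu : ContDiff ℝ (⊤ : ℕ∞) u) {η : E3 → ℝ} (hη : ContDiff ℝ (⊤ : ℕ∞) η) :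
    Continuous (integrand u η) := by
  have h3c : ∀ k i j, Continuous (fun x => h3 u x k i j) := fun k i j =>
    (sm_pd (sm_pd (sm_pd hu j) i) k).continuous
  unfold integrand
  refine ((((sm_tA hu).continuous).mul ?_).add (hη.continuous.mul ?_)).add ?_
  · exact continuous_finsetSum _ fun i _ => continuous_finsetSum _ fun j _ =>
      ((sm_sA hu i j).continuous).mul (sm_pd (sm_pd hη j) i).continuous
  · refine continuous_finsetSum _ fun k _ => Continuous.sub ?_ ?_
    · exact (continuous_finsetSum _ fun i _ => h3c k i i).pow 2
    · exact continuous_finsetSum _ fun i _ => continuous_finsetSum _ fun j _ => (h3c k i j).pow 2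
  · exact continuous_finsetSum _ fun k _ => (sm_pd hη k).continuous.mul
      (sm_pd (sm_fA hu) k).continuous

lemma pd_congr {v w : E3 → ℝ} {x : E3} (h : v =ᶠ[nhds x] w) (i : Fin 3) : pd i v x = pd i w x := by
  simp only [pd]; rw [h.fderiv_eq]

lemma pd_congr' {v w : E3 → ℝ} {x : E3} (h : v =ᶠ[nhds x] w) (i : Fin 3) :
    pd i v =ᶠ[nhds x] pd i w := by
  filter_upwards [h.eventuallyEq_nhds] with y hy using pd_congr hy i

lemma integrand_zero {η : E3 → ℝ} {x : E3} (h : η =ᶠ[nhds x] fun _ => 0) :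
    integrand u η x = 0 := by
  have h1 : ∀ i, pd i η x = 0 := fun i => by rw [pd_congr h i, pd_const]
  have h2 : ∀ i j, pd i (pd j η) x = 0 := fun i j => by
    rw [pd_congr (pd_congr' h j) i]
    have : pd j (fun _ => (0:ℝ)) = fun _ => 0 := funext fun x => pd_const 0 j x
    rw [this, pd_const]
  simp [integrand, h1, h2, h.eq_of_nhds]

lemma tw_pos (h : Hyp5 K f u) {x : E3} (hx : x ∈ ball (0 : E3) 5) :
    0 < tA (hs u x) * wA (hs u x) := by
  have hK0 : 0 < K := by have := h.hK; linarith
  have ht := h.hlap x hx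
  have hFl : 1 / K ≤ fA (hs u x) := by rw [h.heq x hx]; exact h.hfl _
  have hF0 : 0 < fA (hs u x) := lt_of_lt_of_le (by positivity) hFl
  have := wA_lower (hs u x) (hs_symm h.hu x) ht hF0
  refine mul_pos ht (lt_of_lt_of_le ?_ this)
  positivity

lemma integrand_le (h : Hyp5 K f u) {x y : E3} (hx : x ∈ ball (0 : E3) 5)
    (hy : y ∈ ball (0 : E3) 5) {f0 : ℝ} (hf0 : f0 = fA (hs u y)) {φ φ1 φ2 : ℝ → ℝ} {B : ℝ}
    (d1 : ∀ s, 0 ≤ s → HasDerivAt φ (φ1 s) s) (d2 : ∀ s, 0 ≤ s → HasDerivAt φ1 (φ2 s) s)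
    (hφ : ∀ s, 0 ≤ s → 0 ≤ φ s)
    (hmain : ∀ X Y : ℝ, |X - 6| ≤ CC1 K * √(gsq u f0 y x) → 0 ≤ Y →
      Y ≤ 4 * gsq u f0 y x + CC1 K * gsq u f0 y x * √(gsq u f0 y x) →
      φ1 (gsq u f0 y x) * X + φ2 (gsq u f0 y x) * Y + CC1 K * φ (gsq u f0 y x)
        + CC1 K * √(gsq u f0 y x) * |φ1 (gsq u f0 y x)| ≤ B) :
    integrand u (fun x => φ (gsq u f0 y x)) x ≤ tA (hs u x) * wA (hs u x) * B := by
  have hK := h.hK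
  have hK0 : 0 < K := by linarith
  have hf0l : 1 / K ≤ f0 := by rw [hf0, h.heq y hy]; exact h.hfl _
  have hf0u : f0 ≤ K := by rw [hf0, h.heq y hy]; exact f_le h _
  have hf0p : 0 < f0 := lt_of_lt_of_le (by positivity) hf0l
  have hFl : 1 / K ≤ fA (hs u x) := by rw [h.heq x hx]; exact h.hfl _
  have hg := sm_sq h.hu f0 y
  have g0 := fun x => sq_nonneg' (u := u) hf0p y x
  have e1 : ∀ i, pd i (fun x => φ (gsq u f0 y x)) = fun x => φ1 (gsq u f0 y x) * pd i (gsq u f0 y) x :=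
    fun i => funext fun x => pd_comp hg (d1 _ (g0 x)) i
  have e2 : ∀ i j, pd i (pd j (fun x => φ (gsq u f0 y x))) x =
      φ2 (gsq u f0 y x) * pd i (gsq u f0 y) x * pd j (gsq u f0 y) x
        + φ1 (gsq u f0 y x) * pd i (pd j (gsq u f0 y)) x := fun i j => by
    rw [e1 j, pd_comp_mul hg (sm_pd hg j) (d2 _ (g0 x)) i]
  have key := pointwise_alg (φ := φ (gsq u f0 y x)) (φ1 := φ1 (gsq u f0 y x))
    (φ2 := φ2 (gsq u f0 y x)) (C1 := CC1 K) hK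
    (CL := K * (K + K ^ 2 + 1)) (CF := K * (K + K ^ 2 + 3)) (by positivity) (by positivity)
    (hs u x) (hs_symm h.hu x) (h.hlap x hx) hFl hf0l hf0u (fun i => x i - y i)
    (fun k => pd k u x - pd k u y) (fun k => pd k (fun x => fA (hs u x)) x) (h3 u x)
    (fun k => (pd_fA h.hu x k).symm) (s := gsq u f0 y x) rfl (F_lip h hx hy hf0)
    (fun k => F_grad h hx k) rfl rfl rfl rfl rfl (hφ _ (g0 x)) hmain
  refine le_trans (le_of_eq ?_) key
  unfold integrand
  congr 1
  · congr 1
    congr 1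
    simp only [e2, pd_sq h.hu, pd_pd_sq h.hu, pd_fA h.hu]
    have c1 : ∀ (S : Fin 3 → Fin 3 → ℝ) (a : Fin 3 → ℝ) (M : Fin 3 → Fin 3 → ℝ) (q : Fin 3 → ℝ)
        (X : Fin 3 → Fin 3 → Fin 3 → ℝ) (p1 p2 : ℝ),
        ∑ i, ∑ j, S i j * (p2 * (2 * a i) * (2 * a j) + p1 * (M i j + 2 * ∑ k, q k * X k i j)) =
        p2 * (4 * ∑ i, ∑ j, S i j * a i * a j) +
          p1 * (∑ i, ∑ j, S i j * M i j + 2 * ∑ k, q k * ∑ i, ∑ j, S i j * X k i j) := by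
      intro S a M q X p1 p2
      simp only [Fin.sum_univ_three]; ring
    exact c1 _ _ _ _ _ _ _
  · refine Finset.sum_congr rfl fun k _ => ?_
    simp only [e1 k, pd_sq h.hu]

lemma main_ineq (hK : 1 ≤ K) : ∃ C2, 0 ≤ C2 ∧ ∀ (f : E3 × ℝ × E3 → ℝ) (u : E3 → ℝ), Hyp5 K f u →
    ∀ y ∈ closedBall (0 : E3) 1, ∀ e, 0 < e → ∀ (E : Set E3) (m : ℝ), MeasurableSet E → E ⊆ ball y 1 →
    (∀ x ∈ E, gsq u (fA (hs u y)) y x ≤ e ∧ gsq u (fA (hs u y)) y x < 1 / (4 * K) / 2 ∧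
      m ≤ tA (hs u x) * wA (hs u x) * (3 * e * (2 * e) ^ (-(10:ℝ)/4))) →
    m * volume.real E ≤ C2 * ∫ x in ball y 1, tA (hs u x) * wA (hs u x) := by
  have hK0 : 0 < K := by linarith
  have hC1 : 0 ≤ CC1 K := by unfold CC1; positivity
  obtain ⟨C2, hC2, hphi⟩ := phi_exists (1 / (4 * K)) (CC1 K) (by positivity) hC1
  refine ⟨C2, hC2, fun f u h y hy e he E m hE hEy hm => ?_⟩
  obtain ⟨φ, φ1, φ2, p1, p2, p3, p4, p5, p6⟩ := hphi e he
  have hy5 : y ∈ ball (0 : E3) 5 := closedBall_subset_ball (by norm_num) hy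
  have hsub : ball y 1 ⊆ ball (0 : E3) 5 := by
    intro x hx
    rw [mem_ball] at *
    rw [mem_closedBall] at hy
    have := dist_triangle x y 0
    linarith
  set f0 := fA (hs u y) with hf0
  have hf0l : 1 / K ≤ f0 := by rw [hf0, h.heq y hy5]; exact h.hfl _
  have hf0p : 0 < f0 := lt_of_lt_of_le (by positivity) hf0l
  have g0 := fun x => sq_nonneg' (u := u) hf0p y x
  have hg := sm_sq h.hu f0 y
  set η : E3 → ℝ := fun x => φ (gsq u f0 y x) with hη
  have hηs : ContDiff ℝ (⊤ : ℕ∞) η := by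
    rw [contDiff_iff_contDiffAt]
    intro x
    exact (p1 _ (g0 x)).comp x hg.contDiffAt
  -- vanishing
  have hfar : ∀ x, 1 / 2 < ‖x - y‖ → η x = 0 := by
    intro x hx
    apply p5
    refine le_trans ?_ (sq_ge (u := u) (f0 := f0) y x)
    calc 1 / (4 * K) = 1 / K * (1 / 2) ^ 2 := by field_simp; norm_num
      _ ≤ f0 * ‖x - y‖ ^ 2 := by gcongr
  have hfar' : ∀ x, x ∉ ball y 1 → η =ᶠ[nhds x] fun _ => 0 := by
    intro x hx
    rw [mem_ball, not_lt, dist_eq_norm] at hx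
    have ho : IsOpen {x : E3 | 1 / 2 < ‖x - y‖} := isOpen_lt (by fun_prop) (by fun_prop)
    filter_upwards [ho.mem_nhds (show x ∈ {x : E3 | 1 / 2 < ‖x - y‖} by
      change 1 / 2 < ‖x - y‖; linarith)] with z hz using hfar z hz
  have hcs : HasCompactSupport η := by
    refine HasCompactSupport.intro (isCompact_closedBall y 1) fun x hx => ?_
    apply hfar
    rw [mem_closedBall, not_le, dist_eq_norm] at hx
    linarith
  have hI := div_identity h.hu hηs hcs
  change ∫ x, integrand u η x = 0 at hI
  have hIb : ∫ x in ball y 1, integrand u η x = 0 := by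
    rw [← hI]
    apply setIntegral_eq_integral_of_forall_compl_eq_zero
    intro x hx
    exact integrand_zero (hfar' x hx)
  have hcI := cont_integrand h.hu hηs
  have hcW : Continuous fun x => tA (hs u x) * wA (hs u x) :=
    (sm_tA h.hu).continuous.mul (sm_wA h.hu).continuous
  have intI : IntegrableOn (integrand u η) (ball y 1) :=
    (hcI.continuousOn.integrableOn_compact (isCompact_closedBall y 1)).mono_set ball_subset_closedBall
  have intW : IntegrableOn (fun x => tA (hs u x) * wA (hs u x)) (ball y 1) :=
    (hcW.continuousOn.integrableOn_compact (isCompact_closedBall y 1)).mono_set ball_subset_closedBall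
  have hEfin : volume E ≠ ⊤ := ne_top_of_le_ne_top measure_ball_lt_top.ne (measure_mono hEy)
  have intE : IntegrableOn (E.indicator fun _ => m) (ball y 1) volume := by
    have : Integrable (E.indicator fun _ : E3 => m) volume :=
      (integrable_indicator_iff hE).2 (integrableOn_const hEfin)
    exact this.integrableOn
  have hle : ∀ x ∈ ball y 1, integrand u η x ≤ C2 * (tA (hs u x) * wA (hs u x)) - E.indicator (fun _ => m) x := by
    intro x hx
    have hW := tw_pos h (hsub hx)
    have hk := integrand_le h (hsub hx) hy5 hf0 p2 p3 p4 (p6 _ (g0 x))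
    refine hk.trans ?_
    by_cases hxE : x ∈ E
    · obtain ⟨a1, a2, a3⟩ := hm x hxE
      rw [if_pos a2, Set.indicator_of_mem hxE]
      have : (2 * e) ^ (-(10:ℝ)/4) ≤ (gsq u f0 y x + e) ^ (-(10:ℝ)/4) := by
        apply rpow_le_rpow_of_nonpos
        · have := g0 x; linarith
        · linarith
        · norm_num
      have h2 : tA (hs u x) * wA (hs u x) * (3 * e * (2 * e) ^ (-(10:ℝ)/4)) ≤
        tA (hs u x) * wA (hs u x) * (3 * e * (gsq u f0 y x + e) ^ (-(10:ℝ)/4)) := by gcongr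
      rw [mul_sub]
      linarith
    · rw [Set.indicator_of_notMem hxE, sub_zero, mul_comm C2]
      gcongr
      have : 0 ≤ (if gsq u f0 y x < 1 / (4 * K) / 2 then 3 * e * (gsq u f0 y x + e) ^ (-(10:ℝ)/4) else 0) := by
        split_ifs
        · have : 0 ≤ gsq u f0 y x + e := by have := g0 x; linarith
          positivity
        · exact le_rfl
      linarith
  have hfin := setIntegral_mono_on intI ((intW.const_mul C2).sub intE) measurableSet_ball hle
  simp only [Pi.sub_apply] at hfin
  rw [hIb, integral_sub (intW.const_mul C2) intE, integral_const_mul,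
    setIntegral_indicator hE, setIntegral_const, Set.inter_eq_right.2 hEy, smul_eq_mul] at hfin
  linarith

end Main


open scoped MatrixOrder in
lemma exists_lin (H : Fin 3 → Fin 3 → ℝ) (hsy : ∀ i j, H i j = H j i) (hF : 0 < fA H)
    (hw : 0 < wA H) : ∃ T : E3 →ₗ[ℝ] E3, |LinearMap.det T| = wA H ∧
      ∀ z : E3, ‖T z‖ ^ 2 = fA H * ∑ i, z i ^ 2 + ∑ k, (∑ i, H k i * z i) ^ 2 := by
  have hA : (Matrix.of H).transpose = Matrix.of H := by ext i j; simp [hsy j i]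
  have hP : (fA H • (1 : Matrix (Fin 3) (Fin 3) ℝ) + (Matrix.of H) * (Matrix.of H)).PosSemidef := by
    refine Matrix.PosSemidef.add (Matrix.PosSemidef.one.smul hF.le) ?_
    have := Matrix.posSemidef_conjTranspose_mul_self (Matrix.of H)
    rwa [Matrix.conjTranspose_eq_transpose_of_trivial, hA] at this
  obtain ⟨B, hB⟩ := CStarAlgebra.nonneg_iff_eq_star_mul_self.mp hP.nonneg
  rw [Matrix.star_eq_conjTranspose, Matrix.conjTranspose_eq_transpose_of_trivial] at hB
  refine ⟨Matrix.toEuclideanLin B, ?_, fun z => ?_⟩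
  · have h1 : LinearMap.det (Matrix.toEuclideanLin B) = B.det := by
      rw [Matrix.toEuclideanLin_eq_toLin_orthonormal, LinearMap.det_toLin]
    have h2 := wA_det H hsy
    rw [hB, Matrix.det_mul, Matrix.det_transpose, ← sq] at h2
    rw [h1]
    have := (sq_eq_sq_iff_abs_eq_abs _ _).1 h2
    rwa [abs_of_pos hw] at this
  · have e : ∀ i j, ∑ k, B k i * B k j = (if i = j then fA H else 0) + ∑ k, H i k * H k j := by
      intro i j
      have := congrFun (congrFun hB i) j
      simp only [Matrix.mul_apply, Matrix.add_apply, Matrix.smul_apply, Matrix.one_apply,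
        Matrix.transpose_apply, Matrix.of_apply] at this
      rw [← this]; simp
    rw [EuclideanSpace.norm_sq_eq]
    have e' : ∀ i, (Matrix.toEuclideanLin B z) i = ∑ j, B i j * z j := by
      intro i
      rw [Matrix.ofLp_toEuclideanLin_apply]
      rfl
    simp only [e', norm_eq_abs, sq_abs]
    obtain ⟨h1, h2, h3⟩ := sym3 hsy
    have e00 := e 0 0
    have e01 := e 0 1
    have e02 := e 0 2
    have e11 := e 1 1
    have e12 := e 1 2
    have e22 := e 2 2
    simp [Fin.sum_univ_three, h1, h2, h3] at e00 e01 e02 e11 e12 e22 ⊢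
    linear_combination z 0 ^ 2 * e00 + z 1 ^ 2 * e11 + z 2 ^ 2 * e22 + 2 * z 0 * z 1 * e01
      + 2 * z 0 * z 2 * e02 + 2 * z 1 * z 2 * e12

lemma vol_ellipsoid (T : E3 →ₗ[ℝ] E3) {W r : ℝ} (hW : 0 < W) (hT : |LinearMap.det T| = W)
    (hr : 0 < r) (y : E3) :
    MeasurableSet {x : E3 | ‖T (x - y)‖ < r} ∧
    volume.real {x : E3 | ‖T (x - y)‖ < r} = W⁻¹ * (r ^ 3 * volume.real (ball (0 : E3) 1)) := by
  have hd : LinearMap.det T ≠ 0 := by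
    intro h; rw [h, abs_zero] at hT; linarith
  have hc : Continuous T := T.continuous_of_finiteDimensional
  constructor
  · exact (isOpen_lt (by fun_prop) continuous_const).measurableSet
  · have e : {x : E3 | ‖T (x - y)‖ < r} = (fun x => x + (-y)) ⁻¹' (T ⁻¹' ball 0 r) := by
      ext x; simp [sub_eq_add_neg]
    rw [Measure.real, e, measure_preimage_add_right, Measure.addHaar_preimage_linearMap _ hd,
      Measure.addHaar_ball_of_pos _ _ hr]
    rw [ENNReal.toReal_mul, ENNReal.toReal_mul, ENNReal.toReal_ofReal (abs_nonneg _),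
      ENNReal.toReal_ofReal (by positivity), abs_inv, hT]
    simp [Measure.real]

lemma taylor_pd {u : E3 → ℝ} (hu : ContDiff ℝ (⊤ : ℕ∞) u) (y : E3) {c : ℝ} (hc : 0 < c) :
    ∀ᶠ x in nhds y, ∀ k, |pd k u x - pd k u y - ∑ i, hs u y k i * (x i - y i)| ≤ c * ‖x - y‖ := by
  rw [Filter.eventually_all]
  intro k
  have h := (sm_da (sm_pd hu k) y).hasFDerivAt.isLittleO.def hc
  filter_upwards [h] with x hx
  rw [fderiv_eq_sum, norm_eq_abs] at hx
  have e : ∑ i, hs u y k i * (x i - y i) = ∑ i, (x - y) i * pd i (pd k u) y :=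
    Finset.sum_congr rfl fun i _ => by
      rw [hs_symm hu y k i, mul_comm]; rfl
  rw [e]; exact hx

lemma mean_value {K : ℝ} (hK : 1 ≤ K) : ∃ C, 0 < C ∧ ∀ (f : E3 × ℝ × E3 → ℝ) (u : E3 → ℝ),
    Hyp5 K f u → ∀ y ∈ closedBall (0 : E3) 1,
    tA (hs u y) ≤ C * ∫ x in ball y 1, tA (hs u x) * wA (hs u x) := by
  have hK0 : 0 < K := by linarith
  obtain ⟨C2, hC2, hmain⟩ := main_ineq hK
  set v := volume.real (ball (0 : E3) 1) with hv
  have hv0 : 0 < v := by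
    rw [hv, Measure.real]
    exact ENNReal.toReal_pos (measure_ball_pos _ _ one_pos).ne' measure_ball_lt_top.ne
  refine ⟨C2 * 32 / (3 * v) + 1, by positivity, fun f u h y hy => ?_⟩
  have hy5 : y ∈ ball (0 : E3) 5 := closedBall_subset_ball (by norm_num) hy
  have hsub : ball y 1 ⊆ ball (0 : E3) 5 := by
    intro x hx
    rw [mem_ball] at *
    rw [mem_closedBall] at hy
    have := dist_triangle x y 0
    linarith
  have hint : 0 ≤ ∫ x in ball y 1, tA (hs u x) * wA (hs u x) :=
    setIntegral_nonneg measurableSet_ball fun x hx => (tw_pos h (hsub hx)).le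
  set f0 := fA (hs u y) with hf0
  have hf0l : 1 / K ≤ f0 := by rw [hf0, h.heq y hy5]; exact h.hfl _
  have hf0p : 0 < f0 := lt_of_lt_of_le (by positivity) hf0l
  have hb := h.hlap y hy5
  have hbw := tw_pos h hy5
  have hw : 0 < wA (hs u y) := (mul_pos_iff_of_pos_left hb).1 hbw
  obtain ⟨T, hT1, hT2⟩ := exists_lin (hs u y) (hs_symm h.hu y) hf0p hw
  have hcW : Continuous fun x => tA (hs u x) * wA (hs u x) :=
    (sm_tA h.hu).continuous.mul (sm_wA h.hu).continuous
  set b0 := tA (hs u y)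
  set W0 := wA (hs u y)
  have ev1 : ∀ᶠ x in nhds y, b0 * W0 / 2 < tA (hs u x) * wA (hs u x) :=
    hcW.continuousAt.eventually (lt_mem_nhds (by change b0 * W0 / 2 < b0 * W0; linarith))
  have ev2 := taylor_pd h.hu y (c := √(f0 / 6)) (by positivity)
  obtain ⟨δ', hδ', hδ2⟩ := Metric.eventually_nhds_iff_ball.1 (ev1.and ev2)
  set δ := min δ' 1
  have hδ : 0 < δ := by positivity
  set e := min (f0 * δ ^ 2) (1 / (4 * K) / 4) with he
  have he0 : 0 < e := by positivity
  have he1 : e ≤ f0 * δ ^ 2 := min_le_left _ _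
  have he2 : e ≤ 1 / (4 * K) / 4 := min_le_right _ _
  set r := √(e / 2) with hr
  have hr0 : 0 < r := by positivity
  have hr2 : r ^ 2 = e / 2 := sq_sqrt (by positivity)
  obtain ⟨hEm, hEv⟩ := vol_ellipsoid T hw hT1 hr0 y
  set E := {x : E3 | ‖T (x - y)‖ < r} with hE
  have hnear : ∀ x ∈ E, ‖x - y‖ < δ := by
    intro x hx
    have h1 : ‖T (x - y)‖ ^ 2 < r ^ 2 := by
      have : ‖T (x - y)‖ < r := hx
      gcongr
    rw [hT2, hr2] at h1
    have h2 : 0 ≤ ∑ k, (∑ i, hs u y k i * (x - y) i) ^ 2 := by positivity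
    have h3 : ∑ i, (x - y) i ^ 2 = ‖x - y‖ ^ 2 := sum_sq_eq x y
    rw [h3] at h1
    have h4 : f0 * ‖x - y‖ ^ 2 < f0 * δ ^ 2 := by linarith
    have h5 := lt_of_mul_lt_mul_left h4 hf0p.le
    exact lt_of_pow_lt_pow_left₀ 2 hδ.le h5
  have hgs : ∀ x ∈ E, gsq u f0 y x < e := by
    intro x hx
    have hxb : x ∈ ball y δ' := by
      rw [mem_ball, dist_eq_norm]
      exact (hnear x hx).trans_le (min_le_left _ _)
    have ht := (hδ2 x hxb).2
    have h1 : ‖T (x - y)‖ ^ 2 < r ^ 2 := by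
      have : ‖T (x - y)‖ < r := hx
      gcongr
    rw [hT2, hr2] at h1
    have h3 : ∑ i, (x - y) i ^ 2 = ‖x - y‖ ^ 2 := sum_sq_eq x y
    rw [h3] at h1
    have h4 : ∀ k, (pd k u x - pd k u y) ^ 2 ≤
        2 * (∑ i, hs u y k i * (x - y) i) ^ 2 + 2 * (f0 / 6 * ‖x - y‖ ^ 2) := by
      intro k
      have a1 := sq_le_sq' (abs_le.1 (ht k)).1 (abs_le.1 (ht k)).2
      rw [mul_pow, sq_sqrt (by positivity)] at a1
      simp only [PiLp.sub_apply]
      nlinarith [sq_nonneg (pd k u x - pd k u y - 2 * ∑ i, hs u y k i * (x i - y i))]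
    have h5 := Finset.sum_le_sum (s := Finset.univ) fun k _ => h4 k
    rw [Finset.sum_add_distrib, ← Finset.mul_sum] at h5
    simp only [Finset.sum_const, Finset.card_univ, Fintype.card_fin, nsmul_eq_mul] at h5
    unfold gsq
    rw [sum_sq_eq]
    push_cast at h5
    linarith
  have hEb : E ⊆ ball y 1 := by
    intro x hx
    rw [mem_ball, dist_eq_norm]
    exact (hnear x hx).trans_le (min_le_right _ _)
  have key := hmain f u h y hy e he0 E ((b0 * W0 / 2) * (3 * e * (2 * e) ^ (-(10:ℝ)/4))) hEm hEb (by
    intro x hx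
    have hxb : x ∈ ball y δ' := by
      rw [mem_ball, dist_eq_norm]
      exact (hnear x hx).trans_le (min_le_left _ _)
    have hg := hgs x hx
    refine ⟨hg.le, ?_, ?_⟩
    · have : 0 < 1 / (4 * K) := by positivity
      linarith
    · have := (hδ2 x hxb).1
      gcongr)
  rw [hEv] at key
  have e1 : e = 2 * r ^ 2 := by rw [hr2]; ring
  have e2 : (2 * e) ^ (-(10:ℝ)/4) = ((2 * r) ^ 5)⁻¹ := by
    have : 2 * e = (2 * r) ^ (2 : ℝ) := by rw [e1, rpow_two]; ring
    rw [this, ← rpow_mul (by positivity)]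
    have : (2:ℝ) * (-(10:ℝ)/4) = -((5:ℕ):ℝ) := by norm_num
    rw [this, rpow_neg (by positivity), rpow_natCast]
  have e3 : (b0 * W0 / 2) * (3 * e * (2 * e) ^ (-(10:ℝ)/4)) * (W0⁻¹ * (r ^ 3 * v)) = 3 / 32 * v * b0 := by
    rw [e2, e1]; field_simp; norm_num
  rw [e3] at key
  set I := ∫ x in ball y 1, tA (hs u x) * wA (hs u x)
  have : b0 ≤ C2 * 32 / (3 * v) * I := by
    have : b0 = 32 / (3 * v) * (3 / 32 * v * b0) := by field_simp
    rw [this]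
    calc 32 / (3 * v) * (3 / 32 * v * b0) ≤ 32 / (3 * v) * (C2 * I) := by gcongr
      _ = _ := by ring
  linarith


/-- cut-off of `u` -/
lemma exists_ext {u : E3 → ℝ} (hu : ContDiffOn ℝ (⊤ : ℕ∞) u (ball (0 : E3) 10)) :
    ∃ v : E3 → ℝ, ContDiff ℝ (⊤ : ℕ∞) v ∧ ∀ x ∈ ball (0 : E3) 5, v =ᶠ[nhds x] u := by
  let g : ContDiffBump (0 : E3) := ⟨5, 8, by norm_num, by norm_num⟩
  refine ⟨fun x => g x * u x, ?_, ?_⟩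
  · rw [contDiff_iff_contDiffAt]
    intro x
    by_cases hx : x ∈ ball (0 : E3) 10
    · exact (g.contDiff.contDiffAt).mul (hu.contDiffAt (isOpen_ball.mem_nhds hx))
    · have ho : IsOpen {x : E3 | 8 < dist x 0} := isOpen_lt continuous_const (by fun_prop)
      have hx' : 8 < dist x 0 := by
        rw [mem_ball, not_lt] at hx; linarith
      have : (fun x => g x * u x) =ᶠ[nhds x] fun _ => 0 := by
        filter_upwards [ho.mem_nhds hx'] with z hz
        have : g z = 0 := g.zero_of_le_dist (le_of_lt hz)
        rw [this, zero_mul]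
      exact contDiffAt_const.congr_of_eventuallyEq this
  · intro x hx
    filter_upwards [isOpen_ball.mem_nhds hx] with z hz
    have : g z = 1 := g.one_of_mem_closedBall (ball_subset_closedBall hz)
    rw [this, one_mul]

lemma sigma2_eq (H : Fin 3 → Fin 3 → ℝ) (hsy : ∀ i j, H i j = H j i) :
    sigma2 (Matrix.of H) = fA H := by
  obtain ⟨h1, h2, h3⟩ := sym3 hsy
  simp [sigma2, fA, tA, Matrix.trace, Matrix.mul_apply, Fin.sum_univ_three, h1, h2, h3]
  ring


/-- Mean value inequality: if `Δu` attains its maximum over the closed unit ball at `y₀`, then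
`Δu(y₀) ≤ C ∫_{B₁(y₀)} Δu · (F·Δu − det D²u) dx`. -/
theorem stmt_10 :
    ∀ K : ℝ, 1 ≤ K → ∃ C : ℝ, 0 < C ∧
      ∀ (f : E3 × ℝ × E3 → ℝ) (u : E3 → ℝ), Hyp K f u →
        ∀ y₀ ∈ closedBall (0 : E3) 1,
          (∀ y ∈ closedBall (0 : E3) 1, lap u y ≤ lap u y₀) →
          lap u y₀ ≤ C * ∫ x in ball y₀ 1,
              lap u x * (f (x, u x, grad u x) * lap u x - (hess u x).det) := by
  intro K hK
  obtain ⟨C, hC, hmv⟩ := mean_value hK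
  refine ⟨C, hC, fun f u h y hy _ => ?_⟩
  obtain ⟨hf2, hfl, hfd, hu, heq, hlap, hbd⟩ := h
  obtain ⟨v, hv, hvu⟩ := exists_ext hu
  have hsub10 : ball (0 : E3) 5 ⊆ ball (0 : E3) 10 := ball_subset_ball (by norm_num)
  have c1 : ∀ x ∈ ball (0 : E3) 5, v x = u x := fun x hx => (hvu x hx).eq_of_nhds
  have c2 : ∀ x ∈ ball (0 : E3) 5, grad v x = grad u x := fun x hx => by
    ext i; exact pd_congr (hvu x hx) i
  have c3 : ∀ x ∈ ball (0 : E3) 5, hess u x = Matrix.of (hs v x) := fun x hx => by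
    ext i j; exact (pd_congr (pd_congr' (hvu x hx) j) i).symm
  have c4 : ∀ x ∈ ball (0 : E3) 5, lap u x = tA (hs v x) := fun x hx => by
    simp only [lap, c3 x hx, tA, Matrix.of_apply]
  have c5 : ∀ x ∈ ball (0 : E3) 5, fA (hs v x) = f (x, u x, grad u x) := fun x hx => by
    rw [← heq x (hsub10 hx), c3 x hx, sigma2_eq _ (hs_symm hv x)]
  have H5 : Hyp5 K f v := by
    refine ⟨hK, hf2, hfl, hfd, hv, fun x hx => ?_, fun x hx => ?_, fun x hx => ?_⟩
    · rw [c1 x hx, c2 x hx, c5 x hx]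
    · rw [← c4 x hx]; exact hlap x (hsub10 hx)
    · rw [c1 x hx, c2 x hx]; exact hbd x (hsub10 hx)
  have hy5 : y ∈ ball (0 : E3) 5 := closedBall_subset_ball (by norm_num) hy
  have hsub : ball y 1 ⊆ ball (0 : E3) 5 := by
    intro x hx
    rw [mem_ball] at *
    rw [mem_closedBall] at hy
    have := dist_triangle x y 0
    linarith
  have key := hmv f v H5 y hy
  rw [c4 y hy5]
  refine key.trans (le_of_eq ?_)
  congr 1
  refine setIntegral_congr_fun measurableSet_ball fun x hx => ?_
  have hx5 := hsub hx
  simp only [c4 x hx5, c3 x hx5, ← c5 x hx5, wA]
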